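/- arXiv:1508.00005 — 12 statements merged into one kernel-verified Lean document; each statement's English description precedes it below -/
import Mathlib

section
/- Let V be a finite-dimensional complex vector space and S an invertible linear endomorphism of V with S³ = I. Then there exist linear endomorphisms S₁, S₂ of V with S₁² = S₂² = I, S₁S₂S₁ = S₂S₁S₂ and S₁S₂ = S if and only if the trace of S is an integer (i.e., Tr(S) = n for some n ∈ ℤ). -/
noncomputable def stmtP {V : Type*} [AddCommGroup V] [Module ℂ V]
    (S : Module.End ℂ V) (w : ℂ) : Module.End ℂ V :=
  (1/3 : ℂ) • (1 + w^2 • S + w • S^2)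

lemma stmtP_S {V : Type*} [AddCommGroup V] [Module ℂ V]
    (S : Module.End ℂ V) (h3 : S ^ 3 = 1) (w : ℂ) (hw : w^3 = 1) :
    S * stmtP S w = w • stmtP S w := by
  have e : S * stmtP S w = (1/3 : ℂ) • (S + w^2 • S^2 + w • S^3) := by
    unfold stmtP
    simp only [mul_smul_comm, mul_add, mul_one, pow_succ, pow_zero, one_mul, mul_assoc]
  rw [e, h3]
  unfold stmtP
  match_scalars
  · linear_combination (-1/3 : ℂ) * hw
  · ring
  · ring

lemma stmtP_mul {V : Type*} [AddCommGroup V] [Module ℂ V]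
    (S : Module.End ℂ V) (h3 : S ^ 3 = 1) (w v : ℂ) (hv : v^3 = 1) :
    stmtP S w * stmtP S v = ((1 + w^2 * v + w * v^2)/3) • stmtP S v := by
  have h1 := stmtP_S S h3 v hv
  have h2 : S^2 * stmtP S v = v^2 • stmtP S v := by
    rw [pow_two, mul_assoc, h1, mul_smul_comm, h1, smul_smul, pow_two]
  conv_lhs => rw [stmtP]
  rw [smul_mul_assoc, add_mul, add_mul, one_mul, smul_mul_assoc, smul_mul_assoc, h1, h2]
  module

lemma stmt_tr {V : Type*} [AddCommGroup V] [Module ℂ V] [FiniteDimensional ℂ V]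
    (P : Module.End ℂ V) (h : P * P = P) :
    LinearMap.trace ℂ V P = (Module.finrank ℂ (LinearMap.range P) : ℂ) := by
  apply LinearMap.IsProj.trace
  refine ⟨fun x => ⟨x, rfl⟩, ?_⟩
  rintro _ ⟨x, rfl⟩
  exact LinearMap.congr_fun h x

lemma stmt_AB {V : Type*} [AddCommGroup V] [Module ℂ V] [FiniteDimensional ℂ V]
    (P Q : Module.End ℂ V) (hP : P * P = P) (hQ : Q * Q = Q)
    (h : Module.finrank ℂ (LinearMap.range P) = Module.finrank ℂ (LinearMap.range Q)) :
    ∃ A B : Module.End ℂ V, Q * A = A ∧ A * P = A ∧ P * B = B ∧ B * Q = B ∧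
      B * A = P ∧ A * B = Q := by
  let e := LinearEquiv.ofFinrankEq _ _ h
  have hP' : ∀ x : LinearMap.range P, P x = x := by
    rintro ⟨_, x, rfl⟩
    exact LinearMap.congr_fun hP x
  have hQ' : ∀ x : LinearMap.range Q, Q x = x := by
    rintro ⟨_, x, rfl⟩
    exact LinearMap.congr_fun hQ x
  have rP : ∀ x : LinearMap.range P, P.rangeRestrict x = x := fun x => Subtype.ext (hP' x)
  have rQ : ∀ x : LinearMap.range Q, Q.rangeRestrict x = x := fun x => Subtype.ext (hQ' x)
  have rP2 : ∀ x, P.rangeRestrict (P x) = P.rangeRestrict x := fun x => rP (P.rangeRestrict x)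
  have rQ2 : ∀ x, Q.rangeRestrict (Q x) = Q.rangeRestrict x := fun x => rQ (Q.rangeRestrict x)
  refine ⟨(LinearMap.range Q).subtype ∘ₗ e.toLinearMap ∘ₗ P.rangeRestrict,
    (LinearMap.range P).subtype ∘ₗ e.symm.toLinearMap ∘ₗ Q.rangeRestrict, ?_, ?_, ?_, ?_, ?_, ?_⟩
  · ext x; simp [hQ']
  · ext x; simp [rP2]
  · ext x; simp [hP']
  · ext x; simp [rQ2]
  · ext x; simp [rQ]
  · ext x; simp [rP]

theorem stmt_1 {V : Type*} [AddCommGroup V] [Module ℂ V] [FiniteDimensional ℂ V]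
    (S : Module.End ℂ V) (hS : IsUnit S) (h3 : S ^ 3 = 1) :
    (∃ S₁ S₂ : Module.End ℂ V, S₁ ^ 2 = 1 ∧ S₂ ^ 2 = 1 ∧
      S₁ * S₂ * S₁ = S₂ * S₁ * S₂ ∧ S₁ * S₂ = S) ↔
    ∃ n : ℤ, LinearMap.trace ℂ V S = (n : ℂ) := by
  obtain ⟨w, hw, him⟩ : ∃ w : ℂ, w^2 + w + 1 = 0 ∧ w.im ≠ 0 := by
    refine ⟨⟨-1/2, √3/2⟩, ?_, ?_⟩
    · have : √3 * √3 = 3 := Real.mul_self_sqrt (by norm_num)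
      apply Complex.ext
      · simp [pow_two]; linarith
      · simp [pow_two]; ring
    · simp
  have hw3 : w^3 = 1 := by linear_combination (w - 1) * hw
  have hv3 : (w^2)^3 = 1 := by linear_combination (w^3+1) * hw3
  have p0 : stmtP S 1 * stmtP S 1 = stmtP S 1 := by
    rw [stmtP_mul S h3 1 1 (by norm_num)]; norm_num
  have p1 : stmtP S w * stmtP S w = stmtP S w := by
    rw [stmtP_mul S h3 w w hw3]
    rw [show (1 + w^2*w + w*w^2)/3 = 1 by linear_combination 2/3 * hw3, one_smul]
  have p2 : stmtP S (w^2) * stmtP S (w^2) = stmtP S (w^2) := by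
    rw [stmtP_mul S h3 _ _ hv3]
    rw [show (1 + (w^2)^2*w^2 + w^2*(w^2)^2)/3 = 1 by linear_combination 2/3 * hv3, one_smul]
  have z01 : stmtP S 1 * stmtP S w = 0 := by
    rw [stmtP_mul S h3 _ _ hw3, show (1 + 1^2*w + 1*w^2)/3 = 0 by linear_combination 1/3 * hw,
      zero_smul]
  have z02 : stmtP S 1 * stmtP S (w^2) = 0 := by
    rw [stmtP_mul S h3 _ _ hv3, show (1 + 1^2*w^2 + 1*(w^2)^2)/3 = 0 by
      linear_combination 1/3 * hw + w/3 * hw3, zero_smul]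
  have z10 : stmtP S w * stmtP S 1 = 0 := by
    rw [stmtP_mul S h3 _ _ (by norm_num), show (1 + w^2*1 + w*1^2)/3 = 0 by
      linear_combination 1/3 * hw, zero_smul]
  have z20 : stmtP S (w^2) * stmtP S 1 = 0 := by
    rw [stmtP_mul S h3 _ _ (by norm_num), show (1 + (w^2)^2*1 + w^2*1^2)/3 = 0 by
      linear_combination 1/3 * hw + w/3 * hw3, zero_smul]
  have z12 : stmtP S w * stmtP S (w^2) = 0 := by
    rw [stmtP_mul S h3 _ _ hv3, show (1 + w^2*w^2 + w*(w^2)^2)/3 = 0 by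
      linear_combination 1/3 * hw + (w^2+w)/3 * hw3, zero_smul]
  have z21 : stmtP S (w^2) * stmtP S w = 0 := by
    rw [stmtP_mul S h3 _ _ hw3, show (1 + (w^2)^2*w + w^2*w^2)/3 = 0 by
      linear_combination 1/3 * hw + (w^2+w)/3 * hw3, zero_smul]
  have s0 := stmtP_S S h3 1 (by norm_num)
  have s1 := stmtP_S S h3 w hw3
  have s2 := stmtP_S S h3 _ hv3
  have hsum : stmtP S 1 + stmtP S w + stmtP S (w^2) = 1 := by
    unfold stmtP
    match_scalars
    · norm_num
    · linear_combination 1/3 * hw + w/3 * hw3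
    · linear_combination 1/3 * hw
  have hSd : S = stmtP S 1 + w • stmtP S w + w^2 • stmtP S (w^2) := by
    conv_lhs => rw [← mul_one S, ← hsum, mul_add, mul_add, s0, s1, s2, one_smul]
  have hS2d : S^2 = stmtP S 1 + w^2 • stmtP S w + w • stmtP S (w^2) := by
    rw [pow_two]
    nth_rewrite 2 [hSd]
    rw [mul_add, mul_add, mul_smul_comm, mul_smul_comm, s0, s1, s2]
    match_scalars
    · norm_num
    · ring
    · linear_combination w * hw3
  have t0 := stmt_tr _ p0
  have t1 := stmt_tr _ p1
  have t2 := stmt_tr _ p2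
  have tS : LinearMap.trace ℂ V S = _ := congrArg _ hSd
  have tS2 : LinearMap.trace ℂ V (S^2) = _ := congrArg _ hS2d
  simp only [map_add, map_smul, t0, t1, t2, smul_eq_mul] at tS tS2
  constructor
  · rintro ⟨S₁, S₂, h1, h2, hb, h12⟩
    have e : S^2 = S₂ * S₁ := by
      have : S^2 = S₁ * S₂ * S₁ * S₂ := by rw [← h12, pow_two, mul_assoc, mul_assoc, mul_assoc]
      rw [this, hb, mul_assoc, ← pow_two, h2, mul_one]
    have et : LinearMap.trace ℂ V (S^2) = LinearMap.trace ℂ V S := by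
      rw [e, ← h12, LinearMap.trace_mul_comm]
    rw [tS, tS2] at et
    have hne : w - w^2 ≠ 0 := by
      intro h
      have h' : 2 * w + 1 = 0 := by linear_combination h + hw
      have := congrArg Complex.im h'
      simp at this
      exact him this
    have hbc := mul_left_cancel₀ hne (show (w - w^2) * (Module.finrank ℂ (LinearMap.range (stmtP S w)) : ℂ)
        = (w - w^2) * (Module.finrank ℂ (LinearMap.range (stmtP S (w^2))) : ℂ) by
      linear_combination -et)
    refine ⟨(Module.finrank ℂ (LinearMap.range (stmtP S 1)) : ℤ)
      - (Module.finrank ℂ (LinearMap.range (stmtP S w)) : ℤ), ?_⟩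
    rw [tS]
    push_cast
    rw [← hbc]
    linear_combination (Module.finrank ℂ (LinearMap.range (stmtP S w)) : ℂ) * hw
  · rintro ⟨n, hn⟩
    have hfr : Module.finrank ℂ (LinearMap.range (stmtP S w))
        = Module.finrank ℂ (LinearMap.range (stmtP S (w^2))) := by
      rw [tS, show w^2 = -w - 1 by linear_combination hw] at hn
      have := congrArg Complex.im hn
      simp at this
      rw [show w^2 = -w - 1 by linear_combination hw]
      have h' := mul_left_cancel₀ him (show w.im * (Module.finrank ℂ (LinearMap.range (stmtP S w)) : ℝ)
        = w.im * (Module.finrank ℂ (LinearMap.range (stmtP S (-w - 1))) : ℝ) by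
        linear_combination this)
      exact_mod_cast h'
    obtain ⟨A, B, hQA, hAP, hPB, hBQ, hBA, hAB⟩ := stmt_AB _ _ p1 p2 hfr
    clear tS tS2 t0 t1 t2 hn hfr
    generalize stmtP S 1 = P0 at *
    generalize stmtP S w = P at *
    generalize stmtP S (w^2) = Q at *
    have a1 : P0 * A = 0 := by rw [← hQA, ← mul_assoc, z02, zero_mul]
    have a2 : P0 * B = 0 := by rw [← hPB, ← mul_assoc, z01, zero_mul]
    have a3 : A * P0 = 0 := by rw [← hAP, mul_assoc, z10, mul_zero]
    have a4 : B * P0 = 0 := by rw [← hBQ, mul_assoc, z20, mul_zero]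
    have a5 : A * A = 0 := by
      nth_rewrite 1 [← hAP]
      rw [← hQA, mul_assoc, ← mul_assoc P, z12, zero_mul, mul_zero]
    have a6 : B * B = 0 := by
      nth_rewrite 1 [← hBQ]
      rw [← hPB, mul_assoc, ← mul_assoc Q, z21, zero_mul, mul_zero]
    have sA : S * A = w^2 • A := by
      rw [← hQA, ← mul_assoc, s2, smul_mul_assoc]
    have sB : S * B = w • B := by
      rw [← hPB, ← mul_assoc, s1, smul_mul_assoc]
    obtain ⟨T, hT⟩ : ∃ T, T = P0 + A + B := ⟨_, rfl⟩
    have hTT : T * T = 1 := by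
      rw [hT, ← hsum]
      simp only [mul_add, add_mul, p0, a1, a2, a3, a4, a5, a6, hAB, hBA]
      abel
    have hTST : T * (S * T) = S^2 := by
      rw [hS2d, hT]
      simp only [mul_add, add_mul, s0, sA, sB, mul_smul_comm, p0, a1, a2, a3, a4, a5, a6, hAB, hBA]
      module
    have hST : S * T = T * S^2 := by
      rw [← hTST, ← mul_assoc T T, hTT, one_mul]
    refine ⟨T, T * S, by rw [pow_two, hTT], ?_, ?_, ?_⟩
    · rw [pow_two, ← mul_assoc, mul_assoc T S T, hTST, ← pow_succ, h3]
    · rw [← mul_assoc T T, hTT, one_mul, hST, mul_assoc, mul_assoc, ← mul_assoc T T, hTT, one_mul,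
        pow_two]
    · rw [← mul_assoc, hTT, one_mul]
end

section
/- Let V be a nonzero finite-dimensional complex vector space and let (A, A, S₁, S₂) be an irreducible representation of LB₃ (i.e., ρ(σ₁) = ρ(σ₂) = A). Set S = S₁S₂ and suppose S has no nonzero fixed vector (Sv = v implies v = 0). Then dim V is even, and there exist a nonzero μ ∈ ℂ and a primitive third root of unity ζ such that S = μ⁻¹ζ·A². -/
/-- Theorem 2.8 (part): for an irreducible `LB₃` representation with
`ρ(σ₁) = ρ(σ₂) = A` on a nonzero finite-dimensional space such that
`S = S₁S₂` has no nonzero fixed vector, `dim V` is even and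
`S = μ⁻¹ζ·A²` for some nonzero `μ` and primitive third root of unity `ζ`. -/
theorem stmt_4 {V : Type*} [AddCommGroup V] [Module ℂ V] [FiniteDimensional ℂ V]
    [Nontrivial V]
    (A S₁ S₂ : Module.End ℂ V) (hA : IsUnit A)
    (hS1 : S₁ ^ 2 = 1) (hS2 : S₂ ^ 2 = 1)
    (hs : S₁ * S₂ * S₁ = S₂ * S₁ * S₂)
    (hL1 : S₁ * S₂ * A = A * (S₁ * S₂))
    (hL2 : A * A * S₁ = S₂ * (A * A))
    (hirr : ∀ W : Submodule ℂ V,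
      (∀ v ∈ W, A v ∈ W) → (∀ v ∈ W, S₁ v ∈ W) → (∀ v ∈ W, S₂ v ∈ W) →
      W = ⊥ ∨ W = ⊤)
    (hfix : ∀ v : V, (S₁ * S₂) v = v → v = 0) :
    Even (Module.finrank ℂ V) ∧
    ∃ (μ : ℂ) (ζ : ℂ), μ ≠ 0 ∧ IsPrimitiveRoot ζ 3 ∧
      S₁ * S₂ = (μ⁻¹ * ζ) • (A ^ 2) := by
  have h1 : S₁ * S₁ = 1 := by rw [← sq]; exact hS1
  have h2 : S₂ * S₂ = 1 := by rw [← sq]; exact hS2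
  have hSi : (S₁ * S₂) * (S₂ * S₁) = 1 := by
    rw [mul_assoc, ← mul_assoc S₂, h2, one_mul, h1]
  have hiS : (S₂ * S₁) * (S₁ * S₂) = 1 := by
    rw [mul_assoc, ← mul_assoc S₁, h1, one_mul, h2]
  have hSS : (S₁ * S₂) * (S₁ * S₂) = S₂ * S₁ := by
    calc (S₁ * S₂) * (S₁ * S₂) = (S₁ * S₂ * S₁) * S₂ := by simp only [mul_assoc]
      _ = S₂ * S₁ * (S₂ * S₂) := by rw [hs]; simp only [mul_assoc]
      _ = S₂ * S₁ := by rw [h2, mul_one]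
  have hTT : (S₂ * S₁) * (S₂ * S₁) = S₁ * S₂ := by
    calc (S₂ * S₁) * (S₂ * S₁) = (S₂ * S₁ * S₂) * S₁ := by simp only [mul_assoc]
      _ = S₁ * S₂ * (S₁ * S₁) := by rw [← hs]; simp only [mul_assoc]
      _ = S₁ * S₂ := by rw [h1, mul_one]
  have hcA : (S₂ * S₁) * A = A * (S₂ * S₁) := by
    calc (S₂ * S₁) * A = (S₂ * S₁) * (A * (S₁ * S₂)) * (S₂ * S₁) := by
          rw [mul_assoc (S₂ * S₁), mul_assoc A, hSi, mul_one]
      _ = ((S₂ * S₁) * (S₁ * S₂)) * A * (S₂ * S₁) := by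
          rw [← hL1]; simp only [mul_assoc]
      _ = A * (S₂ * S₁) := by rw [hiS, one_mul]
  -- `S² + S + 1 = 0`
  have hsum : S₂ * S₁ + S₁ * S₂ + 1 = 0 := by
    ext v
    apply hfix
    have : (S₁ * S₂) * (S₂ * S₁ + S₁ * S₂ + 1) = S₂ * S₁ + S₁ * S₂ + 1 := by
      rw [mul_add, mul_add, hSi, hSS, mul_one]; abel
    exact congrArg (fun f : Module.End ℂ V => f v) this
  constructor
  · set N : Module.End ℂ V := S₁ * S₂ - S₂ * S₁ with hN
    have hNN : N * N = (-3 : ℂ) • 1 := by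
      have e : N * N = (S₂ * S₁ + S₁ * S₂ + 1) - (3 : ℂ) • 1 := by
        have : N * N = S₂ * S₁ + S₁ * S₂ - 1 - 1 := by
          rw [hN, sub_mul, mul_sub, mul_sub, hSS, hSi, hiS, hTT]; abel
        rw [this]; module
      rw [e, hsum]; module
    have hanti : S₁ * N = (-1 : ℂ) • (N * S₁) := by
      have e1 : S₁ * N = S₂ - S₁ * S₂ * S₁ := by
        rw [hN, mul_sub, ← mul_assoc, h1, one_mul, mul_assoc]
      have e2 : N * S₁ = S₁ * S₂ * S₁ - S₂ := by
        rw [hN, sub_mul, mul_assoc S₂, h1, mul_one]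
      rw [e1, e2]; module
    have d1 := congrArg LinearMap.det hNN
    rw [map_mul, LinearMap.det_smul, map_one, mul_one] at d1
    have dN : LinearMap.det N ≠ 0 := by
      intro h
      rw [h, zero_mul] at d1
      exact pow_ne_zero _ (by norm_num) d1.symm
    have dS : LinearMap.det S₁ ≠ 0 := by
      intro h
      have := congrArg LinearMap.det h1
      rw [map_mul, h, map_one] at this
      simp at this
    have d2 := congrArg LinearMap.det hanti
    rw [LinearMap.det_smul, map_mul, map_mul] at d2
    have d3 : (-1 : ℂ) ^ Module.finrank ℂ V = 1 := by
      apply mul_right_cancel₀ (mul_ne_zero dN dS)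
      rw [← d2]; ring
    exact (neg_one_pow_eq_one_iff_even (by norm_num)).mp d3
  · set T : Module.End ℂ V := S₂ * S₁ * (A * A) with hT
    have tA : T * A = A * T := by
      rw [hT, mul_assoc, mul_assoc A A, ← mul_assoc, hcA, mul_assoc]
    have t1 : T * S₁ = S₁ * T := by
      calc T * S₁ = S₂ * S₁ * (A * A * S₁) := by rw [hT, mul_assoc]
        _ = (S₂ * S₁ * S₂) * (A * A) := by rw [hL2]; simp only [mul_assoc]
        _ = S₁ * T := by rw [← hs, hT]; simp only [mul_assoc]
    have tS : T * (S₁ * S₂) = (S₁ * S₂) * T := by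
      calc T * (S₁ * S₂) = S₂ * S₁ * (A * (A * (S₁ * S₂))) := by
            rw [hT]; simp only [mul_assoc]
        _ = (S₂ * S₁) * (S₁ * S₂) * (A * A) := by
            rw [← hL1, ← mul_assoc A, ← hL1]; simp only [mul_assoc]
        _ = (S₁ * S₂) * T := by rw [hiS, hT, ← mul_assoc (S₁ * S₂), hSi]
    have e2 : S₂ = S₁ * (S₁ * S₂) := by rw [← mul_assoc, h1, one_mul]
    have t2 : T * S₂ = S₂ * T := by
      rw [e2, ← mul_assoc, t1, mul_assoc, tS]; simp only [mul_assoc]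
    obtain ⟨c, hc⟩ := Module.End.exists_eigenvalue T
    have inv : ∀ B : Module.End ℂ V, T * B = B * T →
        ∀ v ∈ T.eigenspace c, B v ∈ T.eigenspace c := by
      intro B hB v hv
      rw [Module.End.mem_eigenspace_iff] at hv ⊢
      have := congrArg (fun f : Module.End ℂ V => f v) hB
      simp only [Module.End.mul_apply] at this
      rw [this, hv, map_smul]
    have htop : T.eigenspace c = ⊤ :=
      (hirr _ (inv A tA) (inv S₁ t1) (inv S₂ t2)).resolve_left hc
    have hTc : T = c • 1 := by
      ext v
      have : v ∈ T.eigenspace c := htop ▸ Submodule.mem_top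
      simpa using Module.End.mem_eigenspace_iff.mp this
    have hAA : A ^ 2 = c • (S₁ * S₂) := by
      calc A ^ 2 = (S₁ * S₂) * T := by rw [hT, ← mul_assoc, hSi, one_mul, sq]
        _ = c • (S₁ * S₂) := by rw [hTc, mul_smul_comm, mul_one]
    have hc0 : c ≠ 0 := by
      rintro rfl
      rw [zero_smul] at hAA
      exact (hA.pow 2).ne_zero hAA
    have hz := Complex.isPrimitiveRoot_exp 3 (by norm_num)
    have hz0 := hz.ne_zero (by norm_num)
    refine ⟨c * _, _, mul_ne_zero hc0 hz0, hz, ?_⟩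
    rw [hAA, smul_smul, mul_inv, mul_assoc, mul_assoc, inv_mul_cancel_left₀ hz0,
      inv_mul_cancel₀ hc0, one_smul]
end

section
/- Let (A, B, S₁′, S₂′) be a representation of LB₃ on a finite-dimensional complex vector space and set S′ = S₁′S₂′. Suppose there exists a nonzero k ∈ ℂ with (kAB)³ = I and Tr(kAB) ∈ ℤ (i.e., a standard extension is possible for k). Then S := kB²S′ satisfies SA = BS, S³ = I, Tr(S) ∈ ℤ, and there exist T₁, T₂ with T₁² = T₂² = I, T₁T₂T₁ = T₂T₁T₂ and T₁T₂ = S; that is, (A, B, T₁, T₂) satisfies the relations (B1), (𝔖1), (𝔖2) and (L1) (an extension to the virtual braid group VB₃). In particular, taking S₁′S₂′ = kAB, the choice S = k²B²AB gives such a VB₃ extension. -/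
open Module in
/-- Idempotent endomorphisms with the same trace are Murray-von Neumann equivalent. -/
theorem idem_equiv_end {V : Type*} [AddCommGroup V] [Module ℂ V] [FiniteDimensional ℂ V]
    (p q : V →ₗ[ℂ] V) (hp : IsIdempotentElem p) (hq : IsIdempotentElem q)
    (h : LinearMap.trace ℂ V p = LinearMap.trace ℂ V q) :
    ∃ X Y : V →ₗ[ℂ] V, Y * X = p ∧ X * Y = q ∧ q * X = X ∧ X * p = X ∧ p * Y = Y ∧ Y * q = Y := by
  have tp := (LinearMap.IsIdempotentElem.isProj_range p hp).trace
  have tq := (LinearMap.IsIdempotentElem.isProj_range q hq).trace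
  have hr : finrank ℂ (LinearMap.range p) = finrank ℂ (LinearMap.range q) := by
    rw [tp, tq] at h; exact_mod_cast h
  let e := LinearEquiv.ofFinrankEq _ _ hr
  have fp : ∀ x : LinearMap.range p, p x = x := by
    rintro ⟨_, y, rfl⟩; exact LinearMap.congr_fun hp y
  have fq : ∀ x : LinearMap.range q, q x = x := by
    rintro ⟨_, y, rfl⟩; exact LinearMap.congr_fun hq y
  have gp : ∀ x : LinearMap.range p, p.rangeRestrict x = x := fun x => Subtype.ext (fp x)
  have gq : ∀ x : LinearMap.range q, q.rangeRestrict x = x := fun x => Subtype.ext (fq x)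
  have pp : ∀ x, p.rangeRestrict (p x) = p.rangeRestrict x := fun x =>
    Subtype.ext (LinearMap.congr_fun hp x)
  have qq : ∀ x, q.rangeRestrict (q x) = q.rangeRestrict x := fun x =>
    Subtype.ext (LinearMap.congr_fun hq x)
  refine ⟨(LinearMap.range q).subtype ∘ₗ e.toLinearMap ∘ₗ p.rangeRestrict,
    (LinearMap.range p).subtype ∘ₗ e.symm.toLinearMap ∘ₗ q.rangeRestrict, ?_, ?_, ?_, ?_, ?_, ?_⟩
  · ext x; simp [gq]
  · ext x; simp [gp]
  · ext x; simp [fq]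
  · ext x; simp [pp]
  · ext x; simp [fp]
  · ext x; simp [qq]

theorem idem_trace_nat {d : ℕ} (p : Matrix (Fin d) (Fin d) ℂ) (hp : p * p = p) :
    ∃ n : ℕ, p.trace = n := by
  have h : IsIdempotentElem (Matrix.toLin' p) := by
    unfold IsIdempotentElem
    exact (Matrix.toLin'_mul p p).symm.trans (by rw [hp])
  have := (LinearMap.IsIdempotentElem.isProj_range _ h).trace
  rw [Matrix.trace_toLin'_eq] at this
  exact ⟨_, this⟩

theorem idem_equiv_mat {d : ℕ} (p q : Matrix (Fin d) (Fin d) ℂ) (hp : p * p = p) (hq : q * q = q)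
    (h : p.trace = q.trace) :
    ∃ X Y : Matrix (Fin d) (Fin d) ℂ,
      Y * X = p ∧ X * Y = q ∧ q * X = X ∧ X * p = X ∧ p * Y = Y ∧ Y * q = Y := by
  let φ := (Matrix.toLinAlgEquiv' : Matrix (Fin d) (Fin d) ℂ ≃ₐ[ℂ] _)
  have tr : ∀ m, LinearMap.trace ℂ _ (φ m) = m.trace := fun m => Matrix.trace_toLin'_eq m
  obtain ⟨X, Y, h1, h2, h3, h4, h5, h6⟩ := idem_equiv_end (φ p) (φ q)
    (by unfold IsIdempotentElem; rw [← map_mul, hp])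
    (by unfold IsIdempotentElem; rw [← map_mul, hq]) (by rw [tr, tr, h])
  refine ⟨φ.symm X, φ.symm Y, ?_, ?_, ?_, ?_, ?_, ?_⟩ <;> apply φ.injective <;>
    simp only [map_mul, AlgEquiv.apply_symm_apply] <;> assumption

theorem twisted_sq {K R : Type*} [CommRing K] [Ring R] [Algebra K R] (p X Y : R) (w : K) (hw3 : w ^ 3 = 1)
    (p00 : p * p = p) (a1 : p * X = 0) (a2 : p * Y = 0) (a3 : X * p = 0) (a4 : Y * p = 0)
    (a5 : X * X = 0) (a6 : Y * Y = 0) :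
    (p + w • X + w ^ 2 • Y) * (p + w • X + w ^ 2 • Y) = p + Y * X + X * Y := by
  have b1 : p * (w • X) = 0 := by rw [mul_smul_comm, a1, smul_zero]
  have b2 : p * (w ^ 2 • Y) = 0 := by rw [mul_smul_comm, a2, smul_zero]
  have b3 : (w • X) * p = 0 := by rw [smul_mul_assoc, a3, smul_zero]
  have b4 : (w ^ 2 • Y) * p = 0 := by rw [smul_mul_assoc, a4, smul_zero]
  have b5 : (w • X) * (w • X) = 0 := by rw [smul_mul_smul_comm, a5, smul_zero]
  have b6 : (w ^ 2 • Y) * (w ^ 2 • Y) = 0 := by rw [smul_mul_smul_comm, a6, smul_zero]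
  have b7 : (w • X) * (w ^ 2 • Y) = X * Y := by
    rw [smul_mul_smul_comm, ← pow_succ', hw3, one_smul]
  have b8 : (w ^ 2 • Y) * (w • X) = Y * X := by
    rw [smul_mul_smul_comm, ← pow_succ, hw3, one_smul]
  rw [← b7, ← b8]
  generalize w • X = X' at *
  generalize w ^ 2 • Y = Y' at *
  simp only [mul_add, add_mul, p00, b1, b2, b3, b4, b5, b6]
  abel

/-- An order three matrix with integral trace is a product of two braiding involutions. -/
theorem exists_involutions {d : ℕ} (M : Matrix (Fin d) (Fin d) ℂ) (hM : M ^ 3 = 1)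
    (n : ℤ) (hn : M.trace = n) :
    ∃ T₁ T₂ : Matrix (Fin d) (Fin d) ℂ, T₁ ^ 2 = 1 ∧ T₂ ^ 2 = 1 ∧
      T₁ * T₂ * T₁ = T₂ * T₁ * T₂ ∧ T₁ * T₂ = M := by
  obtain ⟨w, hw, hwi⟩ : ∃ w : ℂ, w ^ 2 = -1 - w ∧ w.im ≠ 0 := by
    have h3 : (√3 : ℝ) * √3 = 3 := Real.mul_self_sqrt (by norm_num)
    refine ⟨⟨-1/2, √3/2⟩, ?_, ?_⟩
    · apply Complex.ext <;> simp [pow_two] <;> nlinarith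
    · simp
  have hw3 : w ^ 3 = 1 := by linear_combination (w - 1) * hw
  have hM3 : M * M * M = 1 := by rw [← hM]; noncomm_ring
  have hM4 : M * M * (M * M) = M := by rw [← mul_assoc, hM3, one_mul]
  have hM5 : M * (M * M) = 1 := by rw [← mul_assoc, hM3]
  set p0 : Matrix (Fin d) (Fin d) ℂ := (1/3 : ℂ) • (1 + M + M * M) with h0
  set p1 : Matrix (Fin d) (Fin d) ℂ := (1/3 : ℂ) • (1 + (w^2) • M + w • (M * M)) with h1
  set p2 : Matrix (Fin d) (Fin d) ℂ := (1/3 : ℂ) • (1 + w • M + (w^2) • (M * M)) with h2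
  have key : ∀ a b c a' b' c' : ℂ,
      (a • (1 : Matrix (Fin d) (Fin d) ℂ) + b • M + c • (M * M)) * (a' • 1 + b' • M + c' • (M * M))
      = (a*a' + b*c' + c*b') • 1 + (a*b' + b*a' + c*c') • M + (a*c'+b*b'+c*a') • (M*M) := by
    intro a b c a' b' c'
    simp only [mul_add, add_mul, smul_mul_assoc, mul_smul_comm, smul_smul, mul_one, one_mul,
      hM3, hM4, hM5]
    module
  have e0 : p0 = (1/3 : ℂ) • 1 + (1/3 : ℂ) • M + (1/3 : ℂ) • (M * M) := by rw [h0]; module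
  have e1 : p1 = (1/3 : ℂ) • 1 + (w^2/3 : ℂ) • M + (w/3 : ℂ) • (M * M) := by rw [h1]; module
  have e2 : p2 = (1/3 : ℂ) • 1 + (w/3 : ℂ) • M + (w^2/3 : ℂ) • (M * M) := by rw [h2]; module
  have eM : M = (0 : ℂ) • 1 + (1 : ℂ) • M + (0 : ℂ) • (M * M) := by module
  have z : (0 : Matrix (Fin d) (Fin d) ℂ) = (0 : ℂ) • 1 + (0 : ℂ) • M + (0 : ℂ) • (M * M) := by
    module
  clear_value p0 p1 p2
  have w4 : w ^ 4 = w := by linear_combination w * hw3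
  have p00 : p0 * p0 = p0 := by rw [e0, key]; congr 2 <;> norm_num
  have p11 : p1 * p1 = p1 := by
    rw [e1, key]; congr 2 <;> congr 1 <;> grind
  have p22 : p2 * p2 = p2 := by
    rw [e2, key]; congr 2 <;> congr 1 <;> grind
  have p01 : p0 * p1 = 0 := by
    rw [e0, e1, key, z]; congr 2 <;> congr 1 <;> grind
  have p02 : p0 * p2 = 0 := by
    rw [e0, e2, key, z]; congr 2 <;> congr 1 <;> grind
  have p10 : p1 * p0 = 0 := by
    rw [e0, e1, key, z]; congr 2 <;> congr 1 <;> grind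
  have p20 : p2 * p0 = 0 := by
    rw [e0, e2, key, z]; congr 2 <;> congr 1 <;> grind
  have p12 : p1 * p2 = 0 := by
    rw [e1, e2, key, z]; congr 2 <;> congr 1 <;> grind
  have p21 : p2 * p1 = 0 := by
    rw [e1, e2, key, z]; congr 2 <;> congr 1 <;> grind
  have hs : p0 + p1 + p2 = 1 := by
    rw [e0, e1, e2, hw]; module
  have hMs : M = p0 + w • p1 + w ^ 2 • p2 := by
    have : p0 + w • p1 + w ^ 2 • p2 = ((1 + w + w^2)/3) • 1 + ((1 + w^3 + w^3)/3) • M +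
        ((1 + w^2 + w^4)/3) • (M * M) := by
      rw [e0, e1, e2]; module
    rw [this, w4, hw3, hw]; module
  obtain ⟨a, ha⟩ := idem_trace_nat p0 p00
  obtain ⟨b, hb⟩ := idem_trace_nat p1 p11
  obtain ⟨c, hc⟩ := idem_trace_nat p2 p22
  have ht : (a : ℂ) + w * b + (-1 - w) * c = n := by
    rw [← hn, hMs, Matrix.trace_add, Matrix.trace_add, Matrix.trace_smul, Matrix.trace_smul,
      ha, hb, hc, hw]; simp
  have hbc : (b : ℝ) = c := by
    have := congrArg Complex.im ht
    simp at this
    apply mul_left_cancel₀ hwi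
    linarith
  have hbc' : p1.trace = p2.trace := by
    rw [hb, hc]; exact_mod_cast hbc
  obtain ⟨X, Y, hYX, hXY, qX, Xp, pY, Yq⟩ := idem_equiv_mat p1 p2 p11 p22 hbc'
  have a1 : p0 * X = 0 := by rw [← qX, ← mul_assoc, p02, zero_mul]
  have a2 : p0 * Y = 0 := by rw [← pY, ← mul_assoc, p01, zero_mul]
  have a3 : X * p0 = 0 := by rw [← Xp, mul_assoc, p10, mul_zero]
  have a4 : Y * p0 = 0 := by rw [← Yq, mul_assoc, p20, mul_zero]
  have a5 : X * X = 0 := by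
    calc X * X = (X * p1) * (p2 * X) := by rw [Xp, qX]
      _ = X * (p1 * p2) * X := by noncomm_ring
      _ = 0 := by rw [p12]; simp
  have a6 : Y * Y = 0 := by
    calc Y * Y = (Y * p2) * (p1 * Y) := by rw [Yq, pY]
      _ = Y * (p2 * p1) * Y := by noncomm_ring
      _ = 0 := by rw [p21]; simp
  have a7 : X * p2 = 0 := by rw [← Xp, mul_assoc, p12, mul_zero]
  have a8 : Y * p1 = 0 := by rw [← Yq, mul_assoc, p21, mul_zero]
  have hTT : (p0 + X + Y) * (p0 + X + Y) = 1 := by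
    simp only [mul_add, add_mul, p00, a1, a2, a3, a4, a5, a6, hYX, hXY]
    rw [← hs]; abel
  have hTM : (p0 + X + Y) * M = p0 + w • X + w ^ 2 • Y := by
    rw [hMs]
    simp only [mul_add, add_mul, mul_smul_comm, p00, p01, p02, a3, a4, a7, a8, Xp, Yq, smul_zero]
    abel
  have hTMTM : (p0 + X + Y) * M * ((p0 + X + Y) * M) = 1 := by
    rw [hTM, twisted_sq p0 X Y w hw3 p00 a1 a2 a3 a4 a5 a6, hYX, hXY, hs]
  generalize p0 + X + Y = T at hTT hTMTM
  have hMT : M * T * M = T := by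
    calc M * T * M = (T * T) * (M * T * M) := by rw [hTT, one_mul]
      _ = T * (T * M * (T * M)) := by noncomm_ring
      _ = T := by rw [hTMTM, mul_one]
  refine ⟨T, T * M, by rw [pow_two, hTT], by rw [pow_two, hTMTM], ?_, ?_⟩
  · calc T * (T * M) * T = (T * T) * (M * T) := by noncomm_ring
      _ = (M * T) * (M * M * M) := by rw [hTT, hM3, one_mul, mul_one]
      _ = (M * T * M) * (M * M) := by noncomm_ring
      _ = T * M * ((T * T)) * M := by rw [hMT, hTT]; noncomm_ring
      _ = T * M * T * (T * M) := by noncomm_ring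
  · rw [← mul_assoc, hTT, one_mul]

/-- The main word identity. -/
theorem cube_word {R : Type*} [Ring R] (A B s t : R) (hB : IsUnit B)
    (hs : s * s = 1)
    (hL1 : s * t * A = B * (s * t)) (hL2 : A * B * s = t * (A * B)) (z : R)
    (hz : A * B * (A * B) * (A * B) = z) (hzs : s * z = z * s) (hzB : B * z = z * B) :
    B ^ 2 * (s * t) * (B ^ 2 * (s * t)) * (B ^ 2 * (s * t)) = z := by
  have h1 : B ^ 2 * (s * t) = B * (s * t * A) := by rw [hL1]; noncomm_ring
  have h2 : s * t * (A * B) * (s * t) * (A * B) * (s * t) = s * (A * B * (A * B)) * t := by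
    calc s * t * (A * B) * (s * t) * (A * B) * (s * t)
        = s * (t * (A * B)) * s * (t * (A * B)) * (s * t) := by simp only [mul_assoc]
      _ = s * (A * B) * (s * s) * (t * (A * B)) * (s * t) := by rw [← hL2]; simp only [mul_assoc]
      _ = s * (A * B) * (t * (A * B)) * (s * t) := by rw [hs, mul_one]
      _ = s * (A * B) * (A * B) * (s * s) * t := by rw [← hL2]; simp only [mul_assoc]
      _ = s * (A * B * (A * B)) * t := by rw [hs, mul_one]; simp only [mul_assoc]
  apply hB.mul_right_cancel
  rw [h1]
  calc B * (s * t * A) * (B * (s * t * A)) * (B * (s * t * A)) * B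
      = B * (s * t * (A * B) * (s * t) * (A * B) * (s * t)) * (A * B) := by
        simp only [mul_assoc]
    _ = B * s * (A * B * (A * B)) * (t * (A * B)) := by rw [h2]; simp only [mul_assoc]
    _ = B * s * (A * B * (A * B) * (A * B)) * s := by rw [← hL2]; simp only [mul_assoc]
    _ = B * (z * (s * s)) := by rw [hz, mul_assoc B, hzs]; simp only [mul_assoc]
    _ = z * B := by rw [hs, mul_one, hzB]


/-- Proposition 2.11: if `(A, B, S₁', S₂')` is an `LB₃` representation and a
standard extension is possible for `k` (i.e. `(kAB)³ = I` and `Tr(kAB) ∈ ℤ`),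
then `S = kB²S'` (where `S' = S₁'S₂'`) satisfies `SA = BS`, `S³ = I`,
`Tr S ∈ ℤ`, and arises as `T₁T₂` for involutions `T₁, T₂` satisfying the braid
relation, i.e. it gives an extension to the virtual braid group `VB₃`.
In particular if `S₁'S₂' = kAB` then `S = k²B²AB`. -/
theorem stmt_6 {d : ℕ} (A B S₁' S₂' : Matrix (Fin d) (Fin d) ℂ)
    (hA : IsUnit A) (hB : IsUnit B)
    (hS1 : S₁' ^ 2 = 1) (hS2 : S₂' ^ 2 = 1)
    (hbr : A * B * A = B * A * B)
    (hs : S₁' * S₂' * S₁' = S₂' * S₁' * S₂')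
    (hL1 : S₁' * S₂' * A = B * (S₁' * S₂'))
    (hL2 : A * B * S₁' = S₂' * (A * B))
    (k : ℂ) (hk : k ≠ 0)
    (hcube : (k • (A * B)) ^ 3 = 1)
    (htr : ∃ n : ℤ, (k • (A * B)).trace = (n : ℂ)) :
    (k • (B ^ 2 * (S₁' * S₂'))) * A = B * (k • (B ^ 2 * (S₁' * S₂'))) ∧
    (k • (B ^ 2 * (S₁' * S₂'))) ^ 3 = 1 ∧
    (∃ n : ℤ, (k • (B ^ 2 * (S₁' * S₂'))).trace = (n : ℂ)) ∧
    (∃ T₁ T₂ : Matrix (Fin d) (Fin d) ℂ, T₁ ^ 2 = 1 ∧ T₂ ^ 2 = 1 ∧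
      T₁ * T₂ * T₁ = T₂ * T₁ * T₂ ∧ T₁ * T₂ = k • (B ^ 2 * (S₁' * S₂'))) ∧
    (S₁' * S₂' = k • (A * B) →
      k • (B ^ 2 * (S₁' * S₂')) = (k ^ 2) • (B ^ 2 * A * B)) := by
  have hs' : S₁' * S₁' = 1 := by rw [← pow_two, hS1]
  have ht' : S₂' * S₂' = 1 := by rw [← pow_two, hS2]
  have hk3 : k ^ 3 ≠ 0 := pow_ne_zero 3 hk
  have hz : A * B * (A * B) * (A * B) = (k ^ 3)⁻¹ • (1 : Matrix (Fin d) (Fin d) ℂ) := by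
    rw [← hcube, smul_pow, smul_smul, inv_mul_cancel₀ hk3, one_smul, pow_succ, pow_two]
  have hw := cube_word A B S₁' S₂' hB hs' hL1 hL2 _ hz (by simp) (by simp)
  have h3 : (k • (B ^ 2 * (S₁' * S₂'))) ^ 3 = 1 := by
    rw [smul_pow, pow_succ (B ^ 2 * (S₁' * S₂')), pow_two (B ^ 2 * (S₁' * S₂')), hw, smul_smul,
      mul_inv_cancel₀ hk3, one_smul]
  have htr' : (k • (B ^ 2 * (S₁' * S₂'))).trace = (k • (A * B)).trace := by
    rw [Matrix.trace_smul, Matrix.trace_smul]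
    congr 1
    calc (B ^ 2 * (S₁' * S₂')).trace = (B * (S₁' * S₂' * A)).trace := by
          rw [hL1, pow_two, mul_assoc]
      _ = (S₁' * S₂' * A * B).trace := Matrix.trace_mul_comm _ _
      _ = (S₁' * (S₂' * (A * B))).trace := by simp only [mul_assoc]
      _ = (S₁' * (A * B * S₁')).trace := by rw [hL2]
      _ = (A * B * S₁' * S₁').trace := Matrix.trace_mul_comm _ _
      _ = (A * B).trace := by rw [mul_assoc, hs', mul_one]
  obtain ⟨n, hn⟩ := htr
  refine ⟨?_, h3, ⟨n, htr'.trans hn⟩, exists_involutions _ h3 n (htr'.trans hn), ?_⟩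
  · rw [smul_mul_assoc, mul_smul_comm, mul_assoc, hL1]
    have e : B ^ 2 * (B * (S₁' * S₂')) = B * (B ^ 2 * (S₁' * S₂')) := by
      simp only [pow_two, mul_assoc]
    rw [e]
  · intro h
    rw [h, mul_smul_comm, smul_smul, ← pow_two, mul_assoc (B ^ 2)]
end

section
/- Let A, B be invertible complex d×d matrices with ABA = BAB, and suppose the characteristic polynomial of B coincides with its minimal polynomial. Then for any S₁, S₂ making (A, B, S₁, S₂) a representation of LB₃, there exist scalars a₀, …, a_{d−1} ∈ ℂ such that S₁S₂ = (∑_{n=0}^{d−1} aₙBⁿ)·A·B. -/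
open Polynomial in
lemma exists_cyc {d : ℕ} (B : Matrix (Fin d) (Fin d) ℂ) :
    ∃ v : Fin d → ℂ, ∀ p : ℂ[X], (aeval B p).mulVec v = 0 → aeval B p = 0 := by
  obtain ⟨x, hx⟩ := Module.exists_ker_toSpanSingleton_eq_annihilator ℂ[X]
    (Module.AEval' (Matrix.toLin' B))
  refine ⟨(Module.AEval'.of _).symm x, fun p hp => ?_⟩
  have key : ∀ w, aeval (Matrix.toLin' B) p w = (aeval B p).mulVec w := fun w => by
    have := Polynomial.aeval_algHom_apply (Matrix.toLinAlgEquiv' (R := ℂ) (n := Fin d)).toAlgHom B p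
    exact congrArg (fun f => f w) this
  have h1 : p ∈ Module.annihilator ℂ[X] (Module.AEval' (Matrix.toLin' B)) := by
    rw [← hx, LinearMap.mem_ker, LinearMap.toSpanSingleton_apply]
    apply (Module.AEval'.of (Matrix.toLin' B)).symm.injective
    rw [map_zero, ← hp, ← key]
    rfl
  rw [← span_minpoly_eq_annihilator, Ideal.mem_span_singleton, Matrix.minpoly_toLin'] at h1
  exact (minpoly.dvd_iff).1 h1

open Polynomial in
lemma centralizer_poly {d : ℕ} (B C : Matrix (Fin d) (Fin d) ℂ)
    (hmin : minpoly ℂ B = B.charpoly) (hC : C * B = B * C) :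
    ∃ a : Fin d → ℂ, C = ∑ n : Fin d, a n • B ^ (n : ℕ) := by
  obtain ⟨v, hv⟩ := exists_cyc B
  let P : (Fin d → ℂ) →ₗ[ℂ] Matrix (Fin d) (Fin d) ℂ :=
    { toFun := fun a => ∑ n : Fin d, a n • B ^ (n : ℕ)
      map_add' := fun a b => by simp [add_smul, Finset.sum_add_distrib]
      map_smul' := fun c a => by simp [Finset.smul_sum, mul_smul] }
  have hP : ∀ a, P a = aeval B (∑ n : Fin d, Polynomial.C (a n) * X ^ (n : ℕ)) := fun a => by
    simp [P, Algebra.smul_def]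
  let T : (Fin d → ℂ) →ₗ[ℂ] (Fin d → ℂ) :=
    { toFun := fun a => (P a).mulVec v
      map_add' := fun a b => by simp [Matrix.add_mulVec]
      map_smul' := fun c a => by simp [Matrix.smul_mulVec] }
  have hinj : Function.Injective T := by
    rw [injective_iff_map_eq_zero]
    intro a ha
    have h1 : (P a).mulVec v = 0 := ha
    rw [hP] at h1
    have h2 := minpoly.dvd ℂ B (hv _ h1)
    have h3 : (∑ n : Fin d, Polynomial.C (a n) * X ^ (n : ℕ)) = 0 := by
      refine eq_zero_of_dvd_of_degree_lt h2 ?_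
      rw [hmin, Matrix.charpoly_degree_eq_dim, Fintype.card_fin]
      exact degree_sum_fin_lt a
    funext i
    have h4 := congrArg (fun p => coeff p (i : ℕ)) h3
    simpa [finsetSum_coeff, coeff_C_mul, coeff_X_pow, Fin.val_inj] using h4
  have hsurj : Function.Surjective T := LinearMap.surjective_of_injective hinj
  have hcomm : ∀ a D, Commute D B → Commute D (P a) := fun a D hD => by
    refine Commute.sum_right _ _ _ fun n _ => ?_
    exact (hD.pow_right _).smul_right _
  obtain ⟨a, ha⟩ := hsurj (C.mulVec v)
  have ha' : (P a).mulVec v = C.mulVec v := ha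
  refine ⟨a, ?_⟩
  change C = P a
  apply Matrix.mulVec_injective
  funext w
  obtain ⟨b, rfl⟩ := hsurj w
  change C.mulVec ((P b).mulVec v) = (P a).mulVec ((P b).mulVec v)
  have h5 : Commute (P a) (P b) := hcomm b _ (hcomm a B (Commute.refl B)).symm
  rw [Matrix.mulVec_mulVec, Matrix.mulVec_mulVec, (hcomm b C hC).eq, h5.eq,
    ← Matrix.mulVec_mulVec, ← Matrix.mulVec_mulVec, ha']

/-- Proposition 2.13: if `A, B` satisfy the braid relation and the
characteristic polynomial of `B` coincides with its minimal polynomial, then in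
any extension of this `B₃` representation to `LB₃` one has
`S₁S₂ = (∑ aₙ Bⁿ)·A·B` for some scalars `a₀, …, a_{d−1}`. -/
theorem stmt_7 {d : ℕ} (A B S₁ S₂ : Matrix (Fin d) (Fin d) ℂ)
    (hA : IsUnit A) (hB : IsUnit B)
    (hbr : A * B * A = B * A * B)
    (hmin : minpoly ℂ B = B.charpoly)
    (hS1 : S₁ ^ 2 = 1) (hS2 : S₂ ^ 2 = 1)
    (hs : S₁ * S₂ * S₁ = S₂ * S₁ * S₂)
    (hL1 : S₁ * S₂ * A = B * (S₁ * S₂))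
    (hL2 : A * B * S₁ = S₂ * (A * B)) :
    ∃ a : Fin d → ℂ, S₁ * S₂ = (∑ n : Fin d, a n • B ^ (n : ℕ)) * A * B := by
  have hAB : IsUnit (A * B) := hA.mul hB
  obtain ⟨U, hU⟩ := hAB
  have h1 : (A * B) * A = B * (A * B) := by rw [hbr, mul_assoc]
  have h2 : (↑U⁻¹ : Matrix (Fin d) (Fin d) ℂ) * B = A * (↑U⁻¹ : Matrix (Fin d) (Fin d) ℂ) := by
    rw [← hU] at h1
    rw [Units.inv_mul_eq_iff_eq_mul, ← mul_assoc, h1, mul_assoc, Units.mul_inv, mul_one]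
  obtain ⟨a, ha⟩ := centralizer_poly B (S₁ * S₂ * (↑U⁻¹ : Matrix (Fin d) (Fin d) ℂ)) hmin (by
    rw [mul_assoc (S₁ * S₂), h2, ← mul_assoc, hL1, mul_assoc])
  refine ⟨a, ?_⟩
  rw [← ha, mul_assoc _ A B, ← hU, mul_assoc, Units.inv_mul, mul_one]
end

section
/- Let (A, B, S₁, S₂) be a representation of LB₃ by complex d×d matrices such that the minimal polynomial of A equals its characteristic polynomial and the minimal polynomial of B equals its characteristic polynomial, and suppose (AB)³ = c·I for some c ∈ ℂ. Then the relation (L2′) BAS₂ = S₁BA holds (i.e., the representation factors through the symmetric loop braid group SLB₃) if and only if S₂B² = B²S₂ and S₁A² = A²S₁. -/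
/-- Proposition 2.16: an `LB₃` representation whose matrices `A, B` have
minimal polynomial equal to characteristic polynomial and with `(AB)³ = cI`
factors through the symmetric loop braid group `SLB₃` (i.e. satisfies (L2′))
iff `S₂` commutes with `B²` and `S₁` commutes with `A²`. -/
theorem stmt_9 {d : ℕ} (A B S₁ S₂ : Matrix (Fin d) (Fin d) ℂ) (c : ℂ)
    (hA : IsUnit A) (hB : IsUnit B)
    (hS1 : S₁ ^ 2 = 1) (hS2 : S₂ ^ 2 = 1)
    (hbr : A * B * A = B * A * B)
    (hs : S₁ * S₂ * S₁ = S₂ * S₁ * S₂)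
    (hL1 : S₁ * S₂ * A = B * (S₁ * S₂))
    (hL2 : A * B * S₁ = S₂ * (A * B))
    (hmA : minpoly ℂ A = A.charpoly)
    (hmB : minpoly ℂ B = B.charpoly)
    (hc : (A * B) ^ 3 = c • 1) :
    B * A * S₂ = S₁ * (B * A) ↔
      (S₂ * B ^ 2 = B ^ 2 * S₂ ∧ S₁ * A ^ 2 = A ^ 2 * S₁) := by
  have hAB : IsUnit (A * B) := hA.mul hB
  have hXY : A * A * (B * A * (A * B)) = c • 1 := by
    rw [← hc]
    calc A * A * (B * A * (A * B)) = A * (A * B * A) * (A * B) := by noncomm_ring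
      _ = A * (B * A * B) * (A * B) := by rw [hbr]
      _ = (A * B) ^ 3 := by noncomm_ring
  have hVW : B * B * (A * B * (B * A)) = c • 1 := by
    apply hB.mul_right_cancel
    calc B * B * (A * B * (B * A)) * B = B * (B * A * B) * (B * A) * B := by noncomm_ring
      _ = B * (A * B * A) * (B * A) * B := by rw [hbr]
      _ = B * (A * B) ^ 3 := by noncomm_ring
      _ = c • 1 * B := by rw [hc]; simp
  have key1 : ∀ S X Y : Matrix (Fin d) (Fin d) ℂ, IsUnit Y → X * Y = c • 1 →
      S * Y = Y * S → S * X = X * S := by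
    intro S X Y hY h hS
    apply hY.mul_right_cancel
    rw [mul_assoc, h, mul_assoc, hS, ← mul_assoc, h]; simp
  have key2 : ∀ S X Y : Matrix (Fin d) (Fin d) ℂ, IsUnit X → X * Y = c • 1 →
      S * X = X * S → S * Y = Y * S := by
    intro S X Y hX h hS
    apply hX.mul_left_cancel
    rw [← mul_assoc, ← mul_assoc, h, ← hS, mul_assoc, h]; simp
  constructor
  · intro h
    constructor
    · rw [pow_two]
      refine key1 S₂ _ _ (hAB.mul (hB.mul hA)) hVW ?_
      rw [← mul_assoc, ← hL2, mul_assoc, ← h]; simp only [mul_assoc]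
    · rw [pow_two]
      refine key1 S₁ _ _ ((hB.mul hA).mul hAB) hXY ?_
      rw [← mul_assoc, ← h, mul_assoc, ← hL2]; simp only [mul_assoc]
  · rintro ⟨-, h⟩
    rw [pow_two] at h
    have h2 := key2 S₁ _ _ (hA.mul hA) hXY h
    apply hAB.mul_right_cancel
    rw [mul_assoc, ← hL2, mul_assoc S₁, h2]; simp only [mul_assoc]
end

section
/- Let A, B be invertible complex d×d matrices with ABA = BAB such that the minimal polynomial of A equals its characteristic polynomial and similarly for B, and suppose no eigenvalue of A is the negation of another eigenvalue of A (for all μ in the spectrum of A, −μ is not in the spectrum of A). Suppose also that a standard extension is possible, i.e., there exists k ∈ ℂ with (kAB)³ = I and Tr(kAB) ∈ ℤ. Then the set of pairs (S₁, S₂) for which (A, B, S₁, S₂) is a representation of LB₃ satisfying (L2′) BAS₂ = S₁BA is finite. -/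
open Polynomial in
theorem aux_restrict {V : Type*} [AddCommGroup V] [Module ℂ V] (f : Module.End ℂ V)
    (W : Submodule ℂ V) (hW : ∀ x ∈ W, f x ∈ W) (p : ℂ[X]) (x : W) :
    ((aeval (LinearMap.restrict f hW) p x : W) : V) = aeval f p (x : V) := by
  induction p using Polynomial.induction_on' generalizing x with
  | add p q hp hq => simp [hp, hq]
  | monomial n a =>
    have : ∀ y : W, (((LinearMap.restrict f hW ^ n) y : W) : V) = (f ^ n) (y : V) := by
      induction n with
      | zero => intro y; simp
      | succ n ih => intro y; simp [pow_succ, Module.End.mul_apply, ih]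
    simp [aeval_monomial, this]

open Polynomial in
theorem aux_idem {V : Type*} [AddCommGroup V] [Module ℂ V] [FiniteDimensional ℂ V]
    (f P : Module.End ℂ V) (hP : IsIdempotentElem P) (hc : Commute f P) :
    ∃ c₁ c₂ : ℂ[X], c₁.Monic ∧ c₂.Monic ∧ c₁ * c₂ = f.charpoly ∧
      aeval f c₁ * P = 0 ∧ aeval f c₂ * (1 - P) = 0 := by
  have hE : ∀ x ∈ LinearMap.range P, f x ∈ LinearMap.range P := by
    rintro _ ⟨y, rfl⟩
    exact ⟨f y, (LinearMap.congr_fun hc.eq y).symm⟩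
  have hF : ∀ x ∈ LinearMap.ker P, f x ∈ LinearMap.ker P := by
    intro x hx
    have h1 : f (P x) = P (f x) := LinearMap.congr_fun hc.eq x
    rw [LinearMap.mem_ker] at hx ⊢
    rw [← h1, hx, map_zero]
  have hcompl : IsCompl (LinearMap.range P) (LinearMap.ker P) :=
    LinearMap.IsIdempotentElem.isCompl hP
  let F := f.restrict hE
  let G := f.restrict hF
  let e := Submodule.prodEquivOfIsCompl _ _ hcompl
  have hψ : F.prodMap G = e.symm.conj f := by
    apply LinearMap.ext
    rintro ⟨x, y⟩
    apply e.injective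
    have h : e (e.symm.conj f (x, y)) = f (e (x, y)) := by
      simp only [LinearEquiv.conj_apply, LinearMap.comp_apply, LinearEquiv.coe_coe,
        LinearEquiv.symm_symm, LinearEquiv.apply_symm_apply]
    rw [h]
    simp [e, F, G, LinearMap.coe_restrict_apply]
  refine ⟨F.charpoly, G.charpoly, F.charpoly_monic, G.charpoly_monic, ?_, ?_, ?_⟩
  · rw [← e.symm.charpoly_conj f, ← hψ, LinearMap.charpoly_prodMap]
  · ext x
    have := aux_restrict f _ hE F.charpoly ⟨P x, ⟨x, rfl⟩⟩
    rw [show f.restrict hE = F from rfl, LinearMap.aeval_self_charpoly] at this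
    simpa using this.symm
  · ext x
    have hx : x - P x ∈ LinearMap.ker P := by
      have h2 : P (P x) = P x := LinearMap.congr_fun hP x
      rw [LinearMap.mem_ker, map_sub, h2, sub_self]
    have := aux_restrict f _ hF G.charpoly ⟨x - P x, hx⟩
    rw [show f.restrict hF = G from rfl, LinearMap.aeval_self_charpoly] at this
    simpa using this.symm

open Polynomial in
theorem aux_idem_matrix {d : ℕ} (A P : Matrix (Fin d) (Fin d) ℂ)
    (hP : IsIdempotentElem P) (hc : Commute A P) :
    ∃ c₁ c₂ : ℂ[X], c₁.Monic ∧ c₂.Monic ∧ c₁ * c₂ = A.charpoly ∧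
      aeval A c₁ * P = 0 ∧ aeval A c₂ * (1 - P) = 0 := by
  let φ : Matrix (Fin d) (Fin d) ℂ ≃ₐ[ℂ] Module.End ℂ (Fin d → ℂ) := Matrix.toLinAlgEquiv'
  obtain ⟨c₁, c₂, h1, h2, h3, h4, h5⟩ := aux_idem (φ A) (φ P) (hP.map φ) (hc.map φ)
  refine ⟨c₁, c₂, h1, h2, ?_, ?_, ?_⟩
  · rw [h3]
    exact Matrix.charpoly_toLin' A
  · apply φ.injective
    rw [map_mul, map_zero, ← h4, aeval_algEquiv]
    rfl
  · apply φ.injective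
    rw [map_mul, map_zero, ← h5, aeval_algEquiv, map_sub, map_one]
    rfl

open Polynomial in
theorem aux_coprime {d : ℕ} (A P : Matrix (Fin d) (Fin d) ℂ) (hmA : minpoly ℂ A = A.charpoly)
    (c₁ c₂ : ℂ[X]) (h : c₁ * c₂ = A.charpoly)
    (h1 : aeval A c₁ * P = 0) (h2 : aeval A c₂ * (1 - P) = 0) : IsCoprime c₁ c₂ := by
  have hne : c₁ * c₂ ≠ 0 := by rw [h]; exact A.charpoly_monic.ne_zero
  rw [← EuclideanDomain.gcd_isUnit_iff]
  obtain ⟨a, ha⟩ := EuclideanDomain.gcd_dvd_left c₁ c₂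
  obtain ⟨b, hb⟩ := EuclideanDomain.gcd_dvd_right c₁ c₂
  set g := EuclideanDomain.gcd c₁ c₂
  have e1 : aeval A (g * a * b) * P = 0 := by
    rw [← ha, mul_comm, map_mul, mul_assoc, h1, mul_zero]
  have e2 : aeval A (g * a * b) * (1 - P) = 0 := by
    rw [show g * a * b = a * c₂ by rw [hb]; ring, map_mul, mul_assoc, h2, mul_zero]
  have e3 : aeval A (g * a * b) = 0 := by
    have : aeval A (g * a * b) = aeval A (g * a * b) * P + aeval A (g * a * b) * (1 - P) := by
      noncomm_ring
    rw [this, e1, e2, add_zero]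
  have hd := minpoly.dvd ℂ A e3
  rw [hmA, ← h] at hd
  have e4 : c₁ * c₂ = g * (g * a * b) := by
    conv_lhs => rw [ha, hb]
    ring
  rw [e4] at hd hne
  obtain ⟨t, ht⟩ := hd
  refine IsUnit.of_mul_eq_one t ?_
  have hn' : g * a * b ≠ 0 := right_ne_zero_of_mul hne
  apply mul_left_cancel₀ hn'
  rw [mul_one]
  conv_rhs => rw [ht]
  ring

open Polynomial in
theorem aux_unique {d : ℕ} (A P Q : Matrix (Fin d) (Fin d) ℂ)
    (c₁ c₂ : ℂ[X]) (h : IsCoprime c₁ c₂)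
    (h1 : aeval A c₁ * P = 0) (h2 : aeval A c₂ * (1 - P) = 0)
    (k1 : aeval A c₁ * Q = 0) (k2 : aeval A c₂ * (1 - Q) = 0) : P = Q := by
  obtain ⟨u, v, huv⟩ := h
  have key : ∀ R : Matrix (Fin d) (Fin d) ℂ, aeval A c₁ * R = 0 → aeval A c₂ * (1 - R) = 0 →
      R = aeval A (v * c₂) := by
    intro R r1 r2
    have a1 : aeval A (u * c₁ + v * c₂) = 1 := by rw [huv, map_one]
    have a2 : aeval A c₂ * R = aeval A c₂ := by
      rw [mul_sub, mul_one, sub_eq_zero] at r2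
      exact r2.symm
    calc R = aeval A (u * c₁ + v * c₂) * R := by rw [a1, one_mul]
      _ = aeval A (v * c₂) := by
        rw [map_add, map_mul, map_mul, add_mul, mul_assoc, r1, mul_assoc, a2, mul_zero, zero_add]
  rw [key P h1 h2, key Q k1 k2]

open Polynomial in
theorem aux_finite {d : ℕ} (A : Matrix (Fin d) (Fin d) ℂ) (hmA : minpoly ℂ A = A.charpoly) :
    {P : Matrix (Fin d) (Fin d) ℂ | IsIdempotentElem P ∧ Commute A P}.Finite := by
  choose c₁ c₂ m1 m2 hc h1 h2 using
    fun P : {P : Matrix (Fin d) (Fin d) ℂ | IsIdempotentElem P ∧ Commute A P} =>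
      aux_idem_matrix A P.1 P.2.1 P.2.2
  have hfin : Finite {m : Multiset ℂ // m ∈ Set.Iic A.charpoly.roots} :=
    (Set.finite_Iic A.charpoly.roots).to_subtype
  have : Finite {P : Matrix (Fin d) (Fin d) ℂ | IsIdempotentElem P ∧ Commute A P} := by
    refine Finite.of_injective (β := {m : Multiset ℂ // m ∈ Set.Iic A.charpoly.roots})
      (fun P => ⟨(c₁ P).roots, ?_⟩) ?_
    · exact Polynomial.roots.le_of_dvd A.charpoly_monic.ne_zero ⟨c₂ P, (hc P).symm⟩
    · intro P Q hPQ
      have hr : (c₁ P).roots = (c₁ Q).roots := congrArg Subtype.val hPQ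
      have e1 : c₁ Q = c₁ P := by
        rw [(IsAlgClosed.splits (c₁ P)).eq_prod_roots_of_monic (m1 P),
          (IsAlgClosed.splits (c₁ Q)).eq_prod_roots_of_monic (m1 Q), hr]
      have e2 : c₂ Q = c₂ P := by
        apply mul_left_cancel₀ (m1 P).ne_zero
        rw [hc P, ← e1, hc Q]
      apply Subtype.ext
      have q1 := h1 Q
      have q2 := h2 Q
      rw [e1] at q1
      rw [e2] at q2
      exact aux_unique A P.1 Q.1 (c₁ P) (c₂ P)
        (aux_coprime A P.1 hmA _ _ (hc P) (h1 P) (h2 P)) (h1 P) (h2 P) q1 q2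
  exact Set.toFinite _

theorem aux_finite_inv {d : ℕ} (A : Matrix (Fin d) (Fin d) ℂ) (hmA : minpoly ℂ A = A.charpoly) :
    {S : Matrix (Fin d) (Fin d) ℂ | S ^ 2 = 1 ∧ Commute A S}.Finite := by
  refine ((aux_finite A hmA).image (fun P => (2 : ℂ) • P - 1)).subset ?_
  rintro S ⟨hS, hc⟩
  refine ⟨(1 / 2 : ℂ) • (1 + S), ⟨?_, ?_⟩, ?_⟩
  · have : (1 + S) * (1 + S) = (2 : ℂ) • (1 + S) := by
      have : (1 + S) * (1 + S) = 1 + S + S + S ^ 2 := by noncomm_ring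
      rw [this, hS, two_smul]
      abel
    rw [IsIdempotentElem, smul_mul_smul_comm, this, smul_smul]
    norm_num
  · exact ((Commute.one_right A).add_right hc).smul_right _
  · simp [smul_smul]

open Polynomial in
theorem aux_sq {d : ℕ} (A S : Matrix (Fin d) (Fin d) ℂ)
    (hspec : ∀ μ ∈ spectrum ℂ A, -μ ∉ spectrum ℂ A) (h : Commute (A * A) S) : Commute A S := by
  rcases Nat.eq_zero_or_pos d with rfl | hd
  · exact Subsingleton.elim _ _
  have : Nonempty (Fin d) := ⟨⟨0, hd⟩⟩
  set C := A * S - S * A with hC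
  have h1 : A * C = C * (-A) := by
    have := h.eq
    rw [hC]
    have e : A * (A * S - S * A) - (A * S - S * A) * (-A) = A * A * S - S * (A * A) := by
      noncomm_ring
    rw [← sub_eq_zero, e, this, sub_self]
  have h2 : ∀ p : ℂ[X], aeval A p * C = C * aeval (-A) p := by
    intro p
    induction p using Polynomial.induction_on' with
    | add p q hp hq => simp only [map_add, add_mul, mul_add, hp, hq]
    | monomial n a =>
      have : A ^ n * C = C * (-A) ^ n := by
        induction n with
        | zero => simp
        | succ n ih => rw [pow_succ, mul_assoc, h1, ← mul_assoc, ih, mul_assoc, ← pow_succ]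
      rw [aeval_monomial, aeval_monomial, mul_assoc, this, ← mul_assoc,
        Algebra.commutes, mul_assoc]
  have h3 := h2 A.charpoly
  rw [Matrix.aeval_self_charpoly, zero_mul] at h3
  have hu : IsUnit (aeval (-A) A.charpoly) := by
    by_contra hn
    rw [← spectrum.zero_mem_iff ℂ, spectrum.map_polynomial_aeval_of_degree_pos _ _
      (by rw [Matrix.charpoly_degree_eq_dim]; simpa using hd)] at hn
    obtain ⟨μ, hμ, hr⟩ := hn
    have r : μ ∈ spectrum ℂ A := Matrix.mem_spectrum_iff_isRoot_charpoly.mpr hr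
    rw [← spectrum.neg_eq] at hμ
    exact hspec μ r (by simpa using hμ)
  have : C = 0 := by
    have := hu.mul_left_eq_zero (a := C)
    exact this.mp h3.symm
  exact sub_eq_zero.mp this

/-- Theorem 2.17: let `A, B` satisfy the braid relation, with minimal
polynomials equal to characteristic polynomials, no eigenvalue of `A` the
negation of another, and suppose a standard extension is possible. Then only
finitely many extensions of `(A, B)` to `LB₃` factor through `SLB₃`. -/
theorem stmt_10 {d : ℕ} (A B : Matrix (Fin d) (Fin d) ℂ)
    (hA : IsUnit A) (hB : IsUnit B)
    (hbr : A * B * A = B * A * B)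
    (hmA : minpoly ℂ A = A.charpoly)
    (hmB : minpoly ℂ B = B.charpoly)
    (hspec : ∀ μ ∈ spectrum ℂ A, -μ ∉ spectrum ℂ A)
    (hstd : ∃ k : ℂ, (k • (A * B)) ^ 3 = 1 ∧
      ∃ n : ℤ, (k • (A * B)).trace = (n : ℂ)) :
    {p : Matrix (Fin d) (Fin d) ℂ × Matrix (Fin d) (Fin d) ℂ |
      p.1 ^ 2 = 1 ∧ p.2 ^ 2 = 1 ∧
      p.1 * p.2 * p.1 = p.2 * p.1 * p.2 ∧
      p.1 * p.2 * A = B * (p.1 * p.2) ∧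
      A * B * p.1 = p.2 * (A * B) ∧
      B * A * p.2 = p.1 * (B * A)}.Finite := by
  obtain ⟨k, hk, -⟩ := hstd
  refine ((aux_finite_inv A hmA).image
    (fun S => (S, A * B * S * (A * B)⁻¹))).subset ?_
  rintro ⟨S₁, S₂⟩ ⟨h1, -, -, -, h5, h6⟩
  simp only at h1 h5 h6
  have hAB : IsUnit (A * B).det := (Matrix.isUnit_iff_isUnit_det _).mp (hA.mul hB)
  refine ⟨S₁, ⟨h1, ?_⟩, ?_⟩
  · apply aux_sq A S₁ hspec
    have hX : A * (k ^ 3 • (B * A * (A * B))) * A = 1 := by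
      rw [← hk, smul_pow, mul_smul_comm, smul_mul_assoc]
      congr 1
      calc A * (B * A * (A * B)) * A = A * B * A * (A * B * A) := by noncomm_ring
        _ = A * B * A * (B * A * B) := by rw [hbr]
        _ = (A * B) ^ 3 := by noncomm_ring
    have hXc : Commute (k ^ 3 • (B * A * (A * B))) S₁ := by
      apply Commute.smul_left
      show B * A * (A * B) * S₁ = S₁ * (B * A * (A * B))
      rw [mul_assoc, h5, ← mul_assoc, h6, mul_assoc]
    set X := k ^ 3 • (B * A * (A * B))
    have e1 : A * A * X = 1 := by
      have := mul_eq_one_comm.mp hX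
      rw [← mul_assoc] at this
      exact this
    have e2 : X * (A * A) = 1 := mul_eq_one_comm.mp e1
    show A * A * S₁ = S₁ * (A * A)
    calc A * A * S₁ = A * A * S₁ * (X * (A * A)) := by rw [e2, mul_one]
      _ = A * A * (S₁ * X) * (A * A) := by simp only [mul_assoc]
      _ = A * A * (X * S₁) * (A * A) := by rw [hXc.eq]
      _ = A * A * X * S₁ * (A * A) := by simp only [mul_assoc]
      _ = S₁ * (A * A) := by rw [e1, one_mul]
  · simp only [Prod.mk.injEq, true_and]
    rw [h5, mul_assoc, Matrix.mul_nonsing_inv _ hAB, mul_one]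
end

section
/- Let V be a two-dimensional complex vector space and let (A, B, S₁, S₂) be an irreducible representation of LB₃ on V with A ≠ B. Then Tr(AB) ≠ 0 and S₁S₂ = −(Tr(AB))⁻¹·AB. -/
lemma aux_comm (M N : Matrix (Fin 2) (Fin 2) ℂ) (h : M * N = N * M)
    (hM : ∀ c : ℂ, M ≠ c • 1) : ∃ p q : ℂ, N = p • 1 + q • M := by
  have h00 := congrFun (congrFun h 0) 0
  have h01 := congrFun (congrFun h 0) 1
  have h10 := congrFun (congrFun h 1) 0
  simp only [Matrix.mul_apply, Fin.sum_univ_two] at h00 h01 h10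
  by_cases hb : M 0 1 = 0
  · by_cases hc : M 1 0 = 0
    · by_cases hd : M 0 0 - M 1 1 = 0
      · exfalso
        apply hM (M 0 0)
        ext i j
        fin_cases i <;> fin_cases j <;> simp [hb, hc]
        linear_combination -hd
      · have e1 : N 0 1 = 0 := by
          apply mul_left_cancel₀ hd
          rw [hb] at h01
          linear_combination h01
        have e2 : N 1 0 = 0 := by
          apply mul_left_cancel₀ hd
          rw [hc] at h10
          linear_combination -h10
        refine ⟨N 0 0 - (N 0 0 - N 1 1) / (M 0 0 - M 1 1) * M 0 0,
          (N 0 0 - N 1 1) / (M 0 0 - M 1 1), ?_⟩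
        ext i j
        fin_cases i <;> fin_cases j <;> simp [hb, hc, e1, e2]
        field_simp
        ring
    · refine ⟨N 0 0 - N 1 0 / M 1 0 * M 0 0, N 1 0 / M 1 0, ?_⟩
      ext i j
      fin_cases i <;> fin_cases j <;> simp [hc]
      · field_simp
        linear_combination -h00
      · field_simp
        linear_combination -h10
  · refine ⟨N 0 0 - N 0 1 / M 0 1 * M 0 0, N 0 1 / M 0 1, ?_⟩
    ext i j
    fin_cases i <;> fin_cases j <;> simp [hb]
    · field_simp
      linear_combination h00
    · field_simp
      linear_combination h01

lemma aux_CH (C : Matrix (Fin 2) (Fin 2) ℂ) (hdet : C.det = 1) : C * C = C.trace • C - 1 := by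
  rw [Matrix.det_fin_two] at hdet
  ext i j
  fin_cases i <;> fin_cases j <;>
    simp [Matrix.mul_apply, Fin.sum_univ_two, Matrix.trace_fin_two]
  · linear_combination -hdet
  · ring
  · ring
  · linear_combination -hdet

lemma aux_trace (C : Matrix (Fin 2) (Fin 2) ℂ) (hdet : C.det = 1) (h3 : C * C * C = 1)
    (hC : ∀ c : ℂ, C ≠ c • 1) : C.trace = -1 := by
  have h := aux_CH C hdet
  set t := C.trace
  have e : (t ^ 2 - 1) • C = (t + 1) • (1 : Matrix (Fin 2) (Fin 2) ℂ) := by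
    have : C * C * C = (t ^ 2 - 1) • C - t • 1 := by
      rw [h, sub_mul, smul_mul_assoc, h, one_mul]
      module
    rw [h3] at this
    rw [add_smul, one_smul]
    nth_rewrite 2 [this]
    abel
  by_cases ht : t ^ 2 - 1 = 0
  · rw [ht, zero_smul] at e
    have := congrFun (congrFun e 0) 0
    simp at this
    linear_combination -this
  · exfalso
    apply hC ((t ^ 2 - 1)⁻¹ * (t + 1))
    rw [mul_smul, ← e, smul_smul, inv_mul_cancel₀ ht, one_smul]

lemma aux_main (A B S T : Matrix (Fin 2) (Fin 2) ℂ) (hA : IsUnit A) (hB : IsUnit B)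
    (hS : S * S = 1) (hT : T * T = 1)
    (hbr : A * B * A = B * A * B) (hs : S * T * S = T * S * T)
    (hL1 : S * T * A = B * (S * T)) (hL2 : A * B * S = T * (A * B)) (hAB : A ≠ B) :
    (A * B).trace ≠ 0 ∧ S * T = (-((A * B).trace)⁻¹) • (A * B) := by
  have cST : (S * T) * (T * S) = 1 := by
    rw [mul_assoc, ← mul_assoc T, hT, one_mul, hS]
  have cTS : (T * S) * (S * T) = 1 := by
    rw [mul_assoc, ← mul_assoc S, hS, one_mul, hT]
  have hD : IsUnit (A * B) := hA.mul hB
  have hCns : ∀ c : ℂ, S * T ≠ c • 1 := by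
    intro c hc
    apply hAB
    have hu : IsUnit (S * T) := .of_mul_eq_one _ cST
    apply hu.mul_left_cancel
    rw [hL1, hc]
    simp
  have hSns : ∀ c : ℂ, S ≠ c • 1 := by
    intro c hc
    have : T = S := by
      apply hD.mul_right_cancel
      rw [← hL2, hc]
      simp
    apply hCns 1
    rw [this, hS, one_smul]
  have hdet : (S * T).det = 1 := by
    have h1 := congrArg Matrix.det hL2
    rw [Matrix.det_mul, Matrix.det_mul T, mul_comm] at h1
    have h2 := mul_right_cancel₀ (((Matrix.isUnit_iff_isUnit_det _).1 hD).ne_zero) h1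
    rw [Matrix.det_mul, ← h2, ← Matrix.det_mul, hS, Matrix.det_one]
  have h3 : (S * T) * (S * T) * (S * T) = 1 := by
    have : (S * T) * (S * T) * (S * T) = (S * T * S) * (T * S * T) := by noncomm_ring
    rw [this, hs]
    have : T * S * T * (T * S * T) = T * (S * (T * T) * S) * T := by noncomm_ring
    rw [this, hT, mul_one, hS, mul_one, hT]
  have htr := aux_trace _ hdet h3 hCns
  -- it suffices that AB is a multiple of ST
  suffices hx : ∃ x : ℂ, A * B = x • (S * T) by
    obtain ⟨x, hx⟩ := hx
    have hx0 : x ≠ 0 := by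
      rintro rfl
      rw [zero_smul] at hx
      exact hD.ne_zero hx
    have ht : (A * B).trace = -x := by
      rw [hx, Matrix.trace_smul, htr]; simp
    rw [ht]
    refine ⟨neg_ne_zero.2 hx0, ?_⟩
    rw [hx, smul_smul, inv_neg, neg_neg, inv_mul_cancel₀ hx0, one_smul]
  have hDX : A * B = (S * T) * ((T * S) * (A * B)) := by
    rw [← mul_assoc, cST, one_mul]
  have hXS : S * ((T * S) * (A * B)) = ((T * S) * (A * B)) * S := by
    rw [mul_assoc (T * S), hL2]
    simp only [← mul_assoc]
    rw [hs]
  have hCinvB : (T * S) * B = A * (T * S) := by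
    calc (T * S) * B = (T * S) * (B * (S * T)) * (T * S) := by
          rw [mul_assoc (T * S), mul_assoc B, cST, mul_one]
      _ = A * (T * S) := by
          rw [← hL1, ← mul_assoc (T * S), cTS, one_mul]
  have hXA : ((T * S) * (A * B)) * A = A * ((T * S) * (A * B)) := by
    rw [mul_assoc (T * S), hbr, mul_assoc B, ← mul_assoc (T * S), hCinvB, mul_assoc]
  obtain ⟨p, q, hX⟩ := aux_comm S _ hXS hSns
  by_cases hq : q = 0
  · refine ⟨p, ?_⟩
    rw [hDX, hX, hq]
    simp
  have hSA : S * A = A * S := by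
    rw [hX, add_mul, mul_add] at hXA
    simp only [smul_mul_assoc, mul_smul_comm, one_mul, mul_one, add_right_inj] at hXA
    exact smul_right_injective _ hq hXA
  obtain ⟨a, b, hAe⟩ := aux_comm S A hSA hSns
  have hBe : B = a • 1 + b • T := by
    have : B = (S * T) * A * (T * S) := by rw [hL1, mul_assoc, cST, mul_one]
    have e : S * T * S * (T * S) = T := by
      rw [hs]
      have : T * S * T * (T * S) = T * (S * (T * T) * S) := by noncomm_ring
      rw [this, hT, mul_one, hS, mul_one]
    rw [this, hAe, mul_add, add_mul]
    simp only [smul_mul_assoc, mul_smul_comm, mul_one]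
    rw [cST, e]
  have hST : S ≠ T := by
    rintro rfl
    exact hAB (hAe.trans hBe.symm)
  have hb : b ≠ 0 := by
    rintro rfl
    exact hAB (by rw [hAe, hBe]; simp)
  have key : (a ^ 2 * b) • (S - T) = 0 := by
    have e1 : A * B * A = (a ^ 3) • 1 + (a ^ 2 * b) • (S + S + T)
        + (a * b ^ 2) • (S * T + T * S + S * S) + b ^ 3 • (S * T * S) := by
      rw [hAe, hBe]
      simp only [mul_add, add_mul, smul_mul_assoc, mul_smul_comm, one_mul, mul_one]
      module
    have e2 : B * A * B = (a ^ 3) • 1 + (a ^ 2 * b) • (T + T + S)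
        + (a * b ^ 2) • (S * T + T * S + T * T) + b ^ 3 • (T * S * T) := by
      rw [hAe, hBe]
      simp only [mul_add, add_mul, smul_mul_assoc, mul_smul_comm, one_mul, mul_one]
      module
    rw [e1, e2, hs, hS, hT] at hbr
    have h' := sub_eq_zero.2 hbr
    rw [← h']
    module
  have ha : a = 0 := by
    rcases smul_eq_zero.1 key with h | h
    · simpa [hb] using h
    · exact absurd (sub_eq_zero.1 h) hST
  refine ⟨b * b, ?_⟩
  rw [hAe, hBe, ha]
  simp [smul_smul]

/-- Theorem 3.1 (first part): for any two-dimensional irreducible `LB₃`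
representation with `A = ρ(σ₁) ≠ ρ(σ₂) = B`, one has `Tr(AB) ≠ 0` and
`ρ(s₁s₂) = −Tr(AB)⁻¹·AB`. -/
theorem stmt_11 {V : Type*} [AddCommGroup V] [Module ℂ V] [FiniteDimensional ℂ V]
    (hdim : Module.finrank ℂ V = 2)
    (A B S₁ S₂ : Module.End ℂ V)
    (hA : IsUnit A) (hB : IsUnit B)
    (hS1 : S₁ ^ 2 = 1) (hS2 : S₂ ^ 2 = 1)
    (hbr : A * B * A = B * A * B)
    (hs : S₁ * S₂ * S₁ = S₂ * S₁ * S₂)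
    (hL1 : S₁ * S₂ * A = B * (S₁ * S₂))
    (hL2 : A * B * S₁ = S₂ * (A * B))
    (hirr : ∀ W : Submodule ℂ V,
      (∀ v ∈ W, A v ∈ W) → (∀ v ∈ W, B v ∈ W) →
      (∀ v ∈ W, S₁ v ∈ W) → (∀ v ∈ W, S₂ v ∈ W) →
      W = ⊥ ∨ W = ⊤)
    (hAB : A ≠ B) :
    LinearMap.trace ℂ V (A * B) ≠ 0 ∧
    S₁ * S₂ = (-(LinearMap.trace ℂ V (A * B))⁻¹) • (A * B) := by
  let bs := Module.finBasisOfFinrankEq ℂ V hdim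
  let f := LinearMap.toMatrixAlgEquiv bs
  have ht : LinearMap.trace ℂ V (A * B) = (f A * f B).trace := by
    rw [← map_mul, LinearMap.trace_eq_matrix_trace ℂ bs]
    rfl
  have hm := aux_main (f A) (f B) (f S₁) (f S₂) (hA.map f) (hB.map f)
    (by rw [← map_mul, ← pow_two, hS1, map_one]) (by rw [← map_mul, ← pow_two, hS2, map_one])
    (by simp only [← map_mul, hbr]) (by simp only [← map_mul, hs])
    (by simp only [← map_mul, hL1]) (by simp only [← map_mul, hL2])
    (fun h => hAB (f.injective h))
  rw [ht]
  refine ⟨hm.1, f.injective ?_⟩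
  rw [map_smul, map_mul, map_mul]
  exact hm.2
end

section
/- Let A, B be invertible complex 2×2 matrices with ABA = BAB and A ≠ B. Then Tr(AB) ≠ 0 and there exist S₁, S₂ such that (A, B, S₁, S₂) is a representation of LB₃ with S₁S₂ = −(Tr(AB))⁻¹·AB. In other words, every two-dimensional representation of B₃ with ρ(σ₁) ≠ ρ(σ₂) admits a standard extension to LB₃. -/
/-- Cayley-Hamilton type identity for 2x2 matrices. -/
lemma aba_identity (A B : Matrix (Fin 2) (Fin 2) ℂ) :
    A * B * A = (A * B).trace • A + A.det • B - (B.trace * A.det) • (1 : Matrix (Fin 2) (Fin 2) ℂ) := by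
  ext i j
  fin_cases i <;> fin_cases j <;>
    simp [Matrix.mul_apply, Fin.sum_univ_two, Matrix.trace_fin_two, Matrix.det_fin_two] <;> ring

/-- If `(A, B)` is a braid pair with `A ≠ B`, then `Tr(AB) = det A = det B`. -/
lemma trace_eq_det (A B : Matrix (Fin 2) (Fin 2) ℂ) (hA : IsUnit A) (hB : IsUnit B)
    (hbr : A * B * A = B * A * B) (hAB : A ≠ B) :
    (A * B).trace = A.det ∧ B.det = A.det ∧ A.det ≠ 0 := by
  have hdA : A.det ≠ 0 := ((Matrix.isUnit_iff_isUnit_det A).1 hA).ne_zero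
  have hdB : B.det ≠ 0 := ((Matrix.isUnit_iff_isUnit_det B).1 hB).ne_zero
  have hd : B.det = A.det := by
    have h := congrArg Matrix.det hbr
    simp only [Matrix.det_mul] at h
    have : A.det * B.det * (B.det - A.det) = 0 := by linear_combination -h
    rcases mul_eq_zero.1 this with h | h
    · exact absurd h (mul_ne_zero hdA hdB)
    · exact sub_eq_zero.1 h
  have ht : A.trace = B.trace := by
    obtain ⟨U, hU⟩ := hA.mul hB
    have h : (U : Matrix (Fin 2) (Fin 2) ℂ) * A = B * U := by
      rw [hU, hbr, mul_assoc]
    have h2 : B = U * A * (↑U⁻¹ : Matrix (Fin 2) (Fin 2) ℂ) := by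
      rw [h, mul_assoc, Units.mul_inv, mul_one]
    rw [h2, Matrix.trace_mul_comm, ← mul_assoc, Units.inv_mul, one_mul]
  refine ⟨?_, hd, hdA⟩
  have h1 := aba_identity A B
  have h2 := aba_identity B A
  rw [Matrix.trace_mul_comm B A, hd, ht] at h2
  rw [hbr, h2] at h1
  have h3 : ((A * B).trace - A.det) • (A - B) = 0 := by
    ext i j
    have := congrFun (congrFun h1 i) j
    simp only [Matrix.sub_apply, Matrix.add_apply, Matrix.smul_apply, smul_eq_mul,
      Matrix.zero_apply] at this ⊢
    linear_combination -this
  rcases smul_eq_zero.1 h3 with h | h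
  · exact sub_eq_zero.1 h
  · exact absurd (sub_eq_zero.1 h) hAB

/-- An involution of trace 0 with `Tr(S R) = 0`. -/
lemma exists_invol (R : Matrix (Fin 2) (Fin 2) ℂ) :
    ∃ S : Matrix (Fin 2) (Fin 2) ℂ, S.trace = 0 ∧ S.det = -1 ∧ (S * R).trace = 0 := by
  by_cases hq : R 0 1 = 0
  · by_cases hs : R 1 0 = 0
    · refine ⟨!![0, 1; 1, 0], ?_, ?_, ?_⟩ <;>
        simp [Matrix.trace_fin_two, Matrix.det_fin_two, Matrix.vecMul, dotProduct, Fin.sum_univ_two, hq, hs]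
    · refine ⟨!![1, -(R 0 0 - R 1 1) / R 1 0; 0, -1], ?_, ?_, ?_⟩ <;>
        simp [Matrix.trace_fin_two, Matrix.det_fin_two, Matrix.vecMul, dotProduct, Fin.sum_univ_two]
      field_simp
      ring
  · refine ⟨!![1, 0; -(R 0 0 - R 1 1) / R 0 1, -1], ?_, ?_, ?_⟩ <;>
      simp [Matrix.trace_fin_two, Matrix.det_fin_two, Matrix.vecMul, dotProduct, Fin.sum_univ_two]
    field_simp
    ring

lemma cayley_two (M : Matrix (Fin 2) (Fin 2) ℂ) :
    M * M = M.trace • M - M.det • (1 : Matrix (Fin 2) (Fin 2) ℂ) := by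
  ext i j
  fin_cases i <;> fin_cases j <;>
    simp [Matrix.mul_apply, Fin.sum_univ_two, Matrix.trace_fin_two, Matrix.det_fin_two] <;> ring

/-- Theorem 3.1 (second part): every two-dimensional `B₃` representation with
`A ≠ B` has `Tr(AB) ≠ 0` and admits a standard extension to `LB₃` with
`S₁S₂ = −Tr(AB)⁻¹·AB`. -/
theorem stmt_12 (A B : Matrix (Fin 2) (Fin 2) ℂ)
    (hA : IsUnit A) (hB : IsUnit B)
    (hbr : A * B * A = B * A * B)
    (hAB : A ≠ B) :
    (A * B).trace ≠ 0 ∧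
    ∃ S₁ S₂ : Matrix (Fin 2) (Fin 2) ℂ,
      S₁ ^ 2 = 1 ∧ S₂ ^ 2 = 1 ∧
      S₁ * S₂ * S₁ = S₂ * S₁ * S₂ ∧
      S₁ * S₂ * A = B * (S₁ * S₂) ∧
      A * B * S₁ = S₂ * (A * B) ∧
      S₁ * S₂ = (-((A * B).trace)⁻¹) • (A * B) := by
  obtain ⟨ht, hd, h0⟩ := trace_eq_det A B hA hB hbr hAB
  have ht0 : (A * B).trace ≠ 0 := ht ▸ h0
  refine ⟨ht0, ?_⟩
  set t := (A * B).trace with htdef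
  obtain ⟨R, hR⟩ : ∃ R, R = (-t⁻¹) • (A * B) := ⟨_, rfl⟩
  have hP : A * B = (-t) • R := by
    rw [hR, smul_smul]; field_simp; simp
  have hRt : R.trace = -1 := by
    rw [hR, Matrix.trace_smul, ← htdef, smul_eq_mul]; field_simp
  have hRd : R.det = 1 := by
    rw [hR, Matrix.det_smul, Matrix.det_mul, hd, ← ht]; simp; field_simp
  obtain ⟨S, hSt, hSd, hSR⟩ := exists_invol R
  have hS : S * S = 1 := by rw [cayley_two, hSt, hSd]; simp
  have hT : S * R * (S * R) = 1 := by
    rw [cayley_two, hSR, Matrix.det_mul, hSd, hRd]; simp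
  have hR2 : R * R = -R - 1 := by rw [cayley_two, hRt, hRd]; simp
  have hR3 : R * R * R = 1 := by
    rw [hR2, sub_mul, neg_mul, hR2]; simp
  have hSS : S * (S * R) = R := by rw [← mul_assoc, hS, one_mul]
  have hc : S * R * R = R * S := by
    have h1 : R * S * R = S := by
      calc R * S * R = (S * S) * (R * S * R) := by rw [hS, one_mul]
        _ = S * (S * R * (S * R)) := by simp only [mul_assoc]
        _ = S := by rw [hT, mul_one]
    calc S * R * R = (R * S * R) * R * R := by rw [h1]
      _ = R * S * (R * R * R) := by simp only [mul_assoc]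
      _ = R * S := by rw [hR3, mul_one]
  refine ⟨S, S * R, by rw [pow_two, hS], by rw [pow_two, hT], ?_, ?_, ?_, by rw [hSS, hR]⟩
  · rw [hSS, mul_assoc (S * R), hSS, hc]
  · rw [hSS]
    have h : A * B * A = B * (A * B) := by rw [hbr, mul_assoc]
    rw [hR, smul_mul_assoc, h, mul_smul_comm]
  · rw [hP, smul_mul_assoc, mul_smul_comm, hc]
end

section
/- Let V be a two-dimensional complex vector space and let (A, B, S₁, S₂) be an irreducible representation of LB₃ on V with A ≠ B. Then the relation (L2′) BAS₂ = S₁BA holds (i.e., the representation factors through the symmetric loop braid group SLB₃) if and only if Tr(B) = 0. -/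
theorem aux_mat (z : ℂ) (hz : z ^ 2 + z + 1 = 0) (A B S T : Matrix (Fin 2) (Fin 2) ℂ)
    (hS : S = !![0, 1; 1, 0]) (hT : T = !![0, z ^ 2; z, 0])
    (hL1 : S * T * A = B * (S * T)) (hL2 : A * B * S = T * (A * B)) :
    B * A * T = S * (B * A) ↔ Matrix.trace B = 0 := by
  have hz3 : z ^ 3 = 1 := by linear_combination (z - 1) * hz
  have hz0 : z ≠ 0 := by rintro rfl; norm_num at hz
  have hz1 : z ≠ 1 := by rintro rfl; norm_num at hz
  have hz1' : z - 1 ≠ 0 := sub_ne_zero.mpr hz1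
  obtain ⟨a, b, c, d, rfl⟩ : ∃ a b c d, A = !![a, b; c, d] :=
    ⟨_, _, _, _, Matrix.eta_fin_two A⟩
  obtain ⟨a', b', c', d', rfl⟩ : ∃ a b c d, B = !![a, b; c, d] :=
    ⟨_, _, _, _, Matrix.eta_fin_two B⟩
  subst hS hT
  simp only [← Matrix.ext_iff, Fin.forall_fin_two, Matrix.mul_fin_two, Matrix.of_apply,
    Matrix.cons_val_zero, Matrix.cons_val_one, Matrix.cons_val', Matrix.cons_val_fin_one,
    Matrix.trace_fin_two] at *
  obtain ⟨⟨h1, h2⟩, h3, h4⟩ := hL1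
  obtain ⟨⟨g1, g2⟩, g3, g4⟩ := hL2
  have ea : a' = a := mul_left_cancel₀ hz0 (by linear_combination -h1)
  have ed : d' = d := mul_left_cancel₀ (pow_ne_zero 2 hz0) (by linear_combination -h4)
  have eb : b' = z ^ 2 * b := mul_left_cancel₀ (pow_ne_zero 2 hz0) (by
    linear_combination -h2 - z * b * hz3)
  have ec : c' = z * c := mul_left_cancel₀ hz0 (by linear_combination -h3)
  subst ea ed eb ec
  have key : d' ^ 2 = z * a' ^ 2 := by
    linear_combination g3
  constructor
  · rintro ⟨⟨k1, k2⟩, k3, k4⟩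
    have key2 : d' ^ 2 = z ^ 2 * a' ^ 2 := by
      linear_combination -k2 + z * b * c * hz3
    have : z * (z - 1) * a' ^ 2 = 0 := by linear_combination key - key2
    have ha : a' = 0 := by simpa [hz0, hz1'] using this
    subst ha
    have hd : d' = 0 := by simpa using key
    simp [hd]
  · intro ht
    have hd : d' = -a' := by linear_combination ht
    subst hd
    have : (z - 1) * a' ^ 2 = 0 := by linear_combination -key
    have ha : a' = 0 := by simpa [hz1'] using this
    subst ha
    refine ⟨⟨?_, ?_⟩, ?_, ?_⟩
    · ring
    · linear_combination z * b * c * hz3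
    · linear_combination 0 * hz
    · ring

theorem exists_omega : ∃ z : ℂ, z ^ 2 + z + 1 = 0 := by
  obtain ⟨s, hs⟩ := IsAlgClosed.exists_pow_nat_eq (-3 : ℂ) (n := 2) (by norm_num)
  exact ⟨(-1 + s) / 2, by linear_combination hs / 4⟩

theorem aux_eig {V : Type*} [AddCommGroup V] [Module ℂ V] (z : ℂ) (hz : z ^ 2 + z + 1 = 0)
    (S T : Module.End ℂ V) (hS : ∀ x, S (S x) = x) (hT : ∀ x, T (T x) = x)
    (hs : ∀ x, S (T (S x)) = T (S (T x))) (hne : S ≠ T) :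
    ∃ v, v ≠ 0 ∧ S (T v) = z • v := by
  have hz1 : z ≠ 1 := by rintro rfl; norm_num at hz
  have hz0 : z ≠ 0 := by rintro rfl; norm_num at hz
  have hz3 : z ^ 3 = 1 := by linear_combination (z - 1) * hz
  by_contra! hcon
  have hk : ∀ v, S (T v) = z • v → v = 0 := fun v h => by
    by_contra h0; exact hcon v h0 h
  -- (P - 1)(P - z²) = 0
  have h1 : ∀ x, T (S x) - S (T x) - z ^ 2 • S (T x) + z ^ 2 • x = 0 := by
    intro x
    apply hk
    have e1 : S (T (T (S x))) = x := by rw [hT, hS]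
    have e2 : S (T (S (T x))) = T (S x) := by rw [hs, hT]
    simp only [map_add, map_sub, map_smul, e1, e2]
    linear_combination (norm := module) (-1 : ℂ) • hz • T (S x) + z • hz • S (T x) - hz3 • x
  have h2 : ∀ x, S (T x) - T (S x) - z ^ 2 • T (S x) + z ^ 2 • x = 0 := by
    intro x
    have := congrArg S (h1 (S x))
    simpa only [map_add, map_sub, map_smul, hS, hs, hT, map_zero] using this
  apply hne
  ext x
  have h3 : (1 - z) • (T (S x) - S (T x)) = 0 := by
    linear_combination (norm := module) h1 x - h2 x - hz • (T (S x) - S (T x))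
  have h4 : T (S x) = S (T x) := by
    simpa [sub_ne_zero.mpr hz1.symm, sub_eq_zero] using h3
  have h5 := h1 x
  have h6 : z ^ 2 • (x - S (T x)) = 0 := by
    rw [h4] at h5
    linear_combination (norm := module) h5
  have h7 : x = S (T x) := by
    simpa [hz0, sub_eq_zero] using h6
  calc S x = S (S (T x)) := by rw [← h7]
    _ = T x := hS _

theorem stmt_15 {V : Type*} [AddCommGroup V] [Module ℂ V] [FiniteDimensional ℂ V]
    (hdim : Module.finrank ℂ V = 2)
    (A B S₁ S₂ : Module.End ℂ V)
    (hA : IsUnit A) (hB : IsUnit B)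
    (hS1 : S₁ ^ 2 = 1) (hS2 : S₂ ^ 2 = 1)
    (hbr : A * B * A = B * A * B)
    (hs : S₁ * S₂ * S₁ = S₂ * S₁ * S₂)
    (hL1 : S₁ * S₂ * A = B * (S₁ * S₂))
    (hL2 : A * B * S₁ = S₂ * (A * B))
    (hirr : ∀ W : Submodule ℂ V,
      (∀ v ∈ W, A v ∈ W) → (∀ v ∈ W, B v ∈ W) →
      (∀ v ∈ W, S₁ v ∈ W) → (∀ v ∈ W, S₂ v ∈ W) →
      W = ⊥ ∨ W = ⊤)
    (hAB : A ≠ B) :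
    B * A * S₂ = S₁ * (B * A) ↔ LinearMap.trace ℂ V B = 0 := by
  have hne : S₁ ≠ S₂ := by
    rintro rfl
    apply hAB
    rw [← pow_two, hS1] at hL1
    simpa using hL1
  have hS : ∀ x, S₁ (S₁ x) = x := fun x => by
    rw [← Module.End.mul_apply, ← pow_two, hS1]; rfl
  have hT : ∀ x, S₂ (S₂ x) = x := fun x => by
    rw [← Module.End.mul_apply, ← pow_two, hS2]; rfl
  have hs' : ∀ x, S₁ (S₂ (S₁ x)) = S₂ (S₁ (S₂ x)) := fun x => DFunLike.congr_fun hs x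
  obtain ⟨z, hz⟩ := exists_omega
  have hz3 : z ^ 3 = 1 := by linear_combination (z - 1) * hz
  have hz0 : z ≠ 0 := by rintro rfl; norm_num at hz
  have hz1 : z ≠ 1 := by rintro rfl; norm_num at hz
  obtain ⟨v, hv0, hv⟩ := aux_eig z hz S₁ S₂ hS hT hs' hne
  have hTv : S₂ v = z • S₁ v := by
    rw [← hS (S₂ v), hv, map_smul]
  have hTw : S₂ (S₁ v) = z ^ 2 • v := by
    have h := hT v
    rw [hTv, map_smul] at h
    calc S₂ (S₁ v) = z ^ 3 • S₂ (S₁ v) := by rw [hz3, one_smul]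
      _ = z ^ 2 • z • S₂ (S₁ v) := by rw [smul_smul]; ring_nf
      _ = _ := by rw [h]
  have hli : LinearIndependent ℂ ![v, S₁ v] := by
    rw [LinearIndependent.pair_iff]
    intro s t hst
    have h1 := congrArg (fun x => S₁ (S₂ x)) hst
    simp only [map_add, map_smul, hTv, hTw, hS, map_zero] at h1
    have h2 : (t * (z - 1) * z) • S₁ v = 0 := by
      linear_combination (norm := module) h1 - z • hst
    have hw0 : S₁ v ≠ 0 := fun h => hv0 (by rw [← hS v, h, map_zero])
    have ht : t = 0 := by
      simpa [hw0, hz0, sub_ne_zero.mpr hz1] using h2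
    subst ht
    refine ⟨?_, rfl⟩
    simpa [hv0] using hst
  let b := basisOfLinearIndependentOfCardEqFinrank hli (by simp [hdim])
  have hb0 : b 0 = v := by simp [b]
  have hb1 : b 1 = S₁ v := by simp [b]
  have hS0 : S₁ (b 0) = b 1 := by rw [hb0, hb1]
  have hS1' : S₁ (b 1) = b 0 := by rw [hb0, hb1, hS]
  have hT0 : S₂ (b 0) = z • b 1 := by rw [hb0, hb1, hTv]
  have hT1 : S₂ (b 1) = z ^ 2 • b 0 := by rw [hb0, hb1, hTw]
  let φ := LinearMap.toMatrixAlgEquiv b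
  have hφS : φ S₁ = !![0, 1; 1, 0] := by
    ext i j
    fin_cases i <;> fin_cases j <;>
      simp [φ, LinearMap.toMatrixAlgEquiv_apply, hS0, hS1']
  have hφT : φ S₂ = !![0, z ^ 2; z, 0] := by
    ext i j
    fin_cases i <;> fin_cases j <;>
      simp [φ, LinearMap.toMatrixAlgEquiv_apply, hT0, hT1]
  have := aux_mat z hz (φ A) (φ B) (φ S₁) (φ S₂) hφS hφT
    (by simp only [← map_mul, hL1]) (by simp only [← map_mul, hL2])
  rw [LinearMap.trace_eq_matrix_trace ℂ b]
  simp only [← map_mul, φ.injective.eq_iff] at this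
  exact this
end

section
/- Let A, B be invertible complex 3×3 matrices with ABA = BAB and A ≠ B. Then there exist k ∈ ℂ and S₁, S₂ such that (A, B, S₁, S₂) is a representation of LB₃ with S₁S₂ = k·AB if and only if Tr(AB) = 0 and Tr((AB)²) = 0. Moreover, for any such extension, k³·det(AB) = 1. -/
open Matrix in
theorem aux_adj (T : Matrix (Fin 3) (Fin 3) ℂ) :
    2 * T.adjugate.trace = T.trace ^ 2 - (T ^ 2).trace := by
  rw [pow_two T, Matrix.adjugate_fin_three]
  simp [Matrix.trace, Fin.sum_univ_three, Matrix.mul_apply]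
  ring

theorem aux_CH_s16 (T : Matrix (Fin 3) (Fin 3) ℂ) :
    T ^ 3 - T.trace • T ^ 2 + T.adjugate.trace • T - T.det • 1 = 0 := by
  rw [pow_succ, pow_two, Matrix.adjugate_fin_three, Matrix.det_fin_three]
  ext i j
  fin_cases i <;> fin_cases j <;>
    simp [Matrix.trace, Fin.sum_univ_three, Matrix.mul_apply] <;> ring

theorem aux_detsub (T : Matrix (Fin 3) (Fin 3) ℂ) (l : ℂ) :
    (T - l • (1 : Matrix (Fin 3) (Fin 3) ℂ)).det
      = T.det - l * T.adjugate.trace + l ^ 2 * T.trace - l ^ 3 := by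
  rw [Matrix.adjugate_fin_three, Matrix.det_fin_three, Matrix.det_fin_three]
  simp [Matrix.trace, Fin.sum_univ_three]
  ring

theorem aux_detS (S₁ S₂ : Matrix (Fin 3) (Fin 3) ℂ) (h1 : S₁ ^ 2 = 1) (h2 : S₂ ^ 2 = 1)
    (h3 : S₁ * S₂ * S₁ = S₂ * S₁ * S₂) : (S₁ * S₂).det = 1 := by
  have e1 := congrArg Matrix.det h1
  have e2 := congrArg Matrix.det h2
  have e3 := congrArg Matrix.det h3
  simp only [Matrix.det_pow, Matrix.det_mul, Matrix.det_one] at *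
  have : S₁.det = S₂.det := by
    linear_combination S₁.det * e2 * (-1) + S₂.det * e1 - e3
  rw [this]; linear_combination e2

/-- The forward direction. -/
theorem aux_fwd (S₁ S₂ : Matrix (Fin 3) (Fin 3) ℂ) (h1 : S₁ ^ 2 = 1) (h2 : S₂ ^ 2 = 1)
    (h3 : S₁ * S₂ * S₁ = S₂ * S₁ * S₂) (hne : S₁ * S₂ ≠ 1) :
    (S₁ * S₂).trace = 0 ∧ ((S₁ * S₂) ^ 2).trace = 0 := by
  have hd := aux_detS S₁ S₂ h1 h2 h3
  rw [pow_two] at h1 h2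
  have hsq : (S₁ * S₂) ^ 2 = S₂ * S₁ := by
    rw [pow_two, ← mul_assoc, h3, mul_assoc, h2, mul_one]
  have hinv : (S₁ * S₂) * (S₂ * S₁) = 1 := by
    rw [mul_assoc, ← mul_assoc S₂, h2, one_mul, h1]
  have hcube : (S₁ * S₂) ^ 3 = 1 := by rw [pow_succ', hsq, hinv]
  have htr : ((S₁ * S₂) ^ 2).trace = (S₁ * S₂).trace := by
    rw [hsq, Matrix.trace_mul_comm]
  have hadj : (S₁ * S₂).adjugate = S₂ * S₁ := by
    have := Matrix.adjugate_mul (S₁ * S₂)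
    rw [hd, one_smul] at this
    calc (S₁ * S₂).adjugate = (S₁ * S₂).adjugate * ((S₁ * S₂) * (S₂ * S₁)) := by rw [hinv, mul_one]
      _ = S₂ * S₁ := by rw [← mul_assoc, this, one_mul]
  have hadjt : (S₁ * S₂).adjugate.trace = (S₁ * S₂).trace := by
    rw [hadj, Matrix.trace_mul_comm]
  have hCH := aux_CH_s16 (S₁ * S₂)
  rw [hadjt, hd, hcube] at hCH
  rw [htr, and_self]
  by_contra ht
  apply hne
  have h4 : (S₁ * S₂).trace • ((S₁ * S₂) - (S₁ * S₂) ^ 2) = 0 := by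
    rw [smul_sub, ← hCH, one_smul]; abel
  have h5 := (smul_eq_zero.mp h4).resolve_left ht
  have h6 : S₁ * S₂ = S₂ * S₁ := by rw [← hsq]; exact sub_eq_zero.mp h5
  have h7 := hinv
  rw [← h6, ← pow_two, hsq, ← h6] at h7
  exact h7

theorem aux_bwd (T : Matrix (Fin 3) (Fin 3) ℂ) (hd : T.det = 1) (ht : T.trace = 0)
    (ht2 : (T ^ 2).trace = 0) :
    ∃ S : Matrix (Fin 3) (Fin 3) ℂ, S * S = 1 ∧ S * T = T ^ 2 * S := by
  have hadj : T.adjugate.trace = 0 := by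
    have := aux_adj T
    rw [ht, ht2] at this
    simpa using this
  obtain ⟨w, hw⟩ : ∃ w : ℂ, IsPrimitiveRoot w 3 :=
    ⟨_, Complex.isPrimitiveRoot_exp 3 (by norm_num)⟩
  have hw3 : w ^ 3 = 1 := hw.pow_eq_one
  have hev : ∀ j : Fin 3, ∃ u : Fin 3 → ℂ, u ≠ 0 ∧ T.mulVec u = (w ^ (j : ℕ)) • u := by
    intro j
    have h0 : (T - (w ^ (j : ℕ)) • (1 : Matrix (Fin 3) (Fin 3) ℂ)).det = 0 := by
      rw [aux_detsub, hd, ht, hadj, pow_right_comm w (j : ℕ) 3, hw3]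
      simp
    obtain ⟨u, hu, h⟩ := Matrix.exists_mulVec_eq_zero_iff.mpr h0
    refine ⟨u, hu, ?_⟩
    rw [Matrix.sub_mulVec, Matrix.smul_mulVec, Matrix.one_mulVec] at h
    exact sub_eq_zero.mp h
  choose u hu hTu using hev
  have hli : LinearIndependent ℂ u := by
    apply Module.End.eigenvectors_linearIndependent' (Matrix.toLin' T)
      (fun j : Fin 3 => w ^ (j : ℕ))
    · intro i j hij
      exact Fin.ext (hw.pow_inj i.2 j.2 hij)
    · intro j
      refine ⟨?_, hu j⟩
      rw [Module.End.mem_eigenspace_iff, Matrix.toLin'_apply]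
      exact hTu j
  let P : Matrix (Fin 3) (Fin 3) ℂ := Matrix.of (fun i j => u j i)
  have hP : IsUnit P := by
    rw [← Matrix.linearIndependent_cols_iff_isUnit]
    exact hli
  let D : Matrix (Fin 3) (Fin 3) ℂ := Matrix.diagonal (fun j : Fin 3 => w ^ (j : ℕ))
  have hTP : T * P = P * D := by
    ext i j
    have := congrFun (hTu j) i
    rw [Matrix.mul_diagonal]
    simp only [Matrix.mulVec, dotProduct, Pi.smul_apply, smul_eq_mul] at this
    simp only [Matrix.mul_apply, P, Matrix.of_apply]
    rw [this, mul_comm]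
  obtain ⟨Q, hPQ, hQP⟩ : ∃ Q, P * Q = 1 ∧ Q * P = 1 := by
    obtain ⟨p, hp⟩ := hP
    exact ⟨↑p⁻¹, by rw [← hp]; simp, by rw [← hp]; simp⟩
  let s : Matrix (Fin 3) (Fin 3) ℂ := !![1, 0, 0; 0, 0, 1; 0, 1, 0]
  have hs : s * s = 1 := by
    ext i j
    fin_cases i <;> fin_cases j <;> simp [s, Matrix.mul_apply, Fin.sum_univ_three]
  have hsD : s * D = D ^ 2 * s := by
    have h4 : w = (w ^ 2) ^ 2 := by linear_combination (-w) * hw3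
    rw [Matrix.diagonal_pow]
    ext i j
    fin_cases i <;> fin_cases j <;>
      simp [s, D, Matrix.mul_diagonal, Matrix.diagonal_mul] <;> exact h4
  have hT : T = P * D * Q := by rw [← hTP, mul_assoc, hPQ, mul_one]
  have hT2 : T ^ 2 = P * D ^ 2 * Q := by
    calc T ^ 2 = P * D * (Q * P) * D * Q := by rw [pow_two, hT]; simp only [mul_assoc]
      _ = _ := by rw [hQP, mul_one, pow_two]; simp only [mul_assoc]
  refine ⟨P * s * Q, ?_, ?_⟩
  · calc P * s * Q * (P * s * Q) = P * s * (Q * P) * s * Q := by simp only [mul_assoc]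
      _ = P * (s * s) * Q := by rw [hQP, mul_one]; simp only [mul_assoc]
      _ = 1 := by rw [hs, mul_one, hPQ]
  · rw [hT2]
    calc P * s * Q * T = P * s * (Q * P) * D * Q := by rw [hT]; simp only [mul_assoc]
      _ = P * (s * D) * Q := by rw [hQP, mul_one]; simp only [mul_assoc]
      _ = P * D ^ 2 * (Q * P) * s * Q := by rw [hsD, hQP, mul_one]; simp only [mul_assoc]
      _ = _ := by simp only [mul_assoc]

/-- Lemma 4.1: a three-dimensional `B₃` representation with `A ≠ B` admits a
standard extension `S₁S₂ = k·AB` to `LB₃` iff `Tr(AB) = Tr((AB)²) = 0`;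
moreover in that case `k³ = det(AB)⁻¹`. -/
theorem stmt_16 (A B : Matrix (Fin 3) (Fin 3) ℂ)
    (hA : IsUnit A) (hB : IsUnit B)
    (hbr : A * B * A = B * A * B)
    (hAB : A ≠ B) :
    ((∃ (k : ℂ) (S₁ S₂ : Matrix (Fin 3) (Fin 3) ℂ),
        S₁ ^ 2 = 1 ∧ S₂ ^ 2 = 1 ∧
        S₁ * S₂ * S₁ = S₂ * S₁ * S₂ ∧
        S₁ * S₂ * A = B * (S₁ * S₂) ∧
        A * B * S₁ = S₂ * (A * B) ∧
        S₁ * S₂ = k • (A * B)) ↔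
      ((A * B).trace = 0 ∧ ((A * B) ^ 2).trace = 0)) ∧
    (∀ (k : ℂ) (S₁ S₂ : Matrix (Fin 3) (Fin 3) ℂ),
      S₁ ^ 2 = 1 → S₂ ^ 2 = 1 →
      S₁ * S₂ * S₁ = S₂ * S₁ * S₂ →
      S₁ * S₂ * A = B * (S₁ * S₂) →
      A * B * S₁ = S₂ * (A * B) →
      S₁ * S₂ = k • (A * B) →
      k ^ 3 * (A * B).det = 1) := by
  have hMA : A * B * A = B * (A * B) := by rw [hbr, mul_assoc]
  have hdet : (A * B).det ≠ 0 := by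
    have := (hA.mul hB)
    rw [Matrix.isUnit_iff_isUnit_det] at this
    exact this.ne_zero
  have key : ∀ (k : ℂ) (S₁ S₂ : Matrix (Fin 3) (Fin 3) ℂ),
      S₁ ^ 2 = 1 → S₂ ^ 2 = 1 →
      S₁ * S₂ * S₁ = S₂ * S₁ * S₂ →
      S₁ * S₂ = k • (A * B) →
      k ^ 3 * (A * B).det = 1 := by
    intro k S₁ S₂ h1 h2 h3 h6
    have := aux_detS S₁ S₂ h1 h2 h3
    rw [h6, Matrix.det_smul] at this
    simpa using this
  refine ⟨⟨?_, ?_⟩, fun k S₁ S₂ h1 h2 h3 _ _ h6 => key k S₁ S₂ h1 h2 h3 h6⟩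
  · rintro ⟨k, S₁, S₂, h1, h2, h3, h4, -, h6⟩
    have hk := key k S₁ S₂ h1 h2 h3 h6
    have hk0 : k ≠ 0 := by rintro rfl; simp at hk
    have hne : S₁ * S₂ ≠ 1 := by
      intro h
      rw [h, one_mul, mul_one] at h4
      exact hAB h4
    have := aux_fwd S₁ S₂ h1 h2 h3 hne
    rw [h6, smul_pow, Matrix.trace_smul, Matrix.trace_smul] at this
    exact ⟨(smul_eq_zero.mp this.1).resolve_left hk0,
      (smul_eq_zero.mp this.2).resolve_left (pow_ne_zero 2 hk0)⟩
  · rintro ⟨ht, ht2⟩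
    obtain ⟨k, hk⟩ := IsAlgClosed.exists_pow_nat_eq ((A * B).det)⁻¹ (n := 3) (by norm_num)
    have hk1 : k ^ 3 * (A * B).det = 1 := by rw [hk, inv_mul_cancel₀ hdet]
    have hk0 : k ≠ 0 := by rintro rfl; simp at hk1
    obtain ⟨T, hT⟩ : ∃ T, T = k • (A * B) := ⟨_, rfl⟩
    have hTd : T.det = 1 := by rw [hT, Matrix.det_smul]; simpa using hk1
    have hTt : T.trace = 0 := by rw [hT, Matrix.trace_smul, ht, smul_zero]
    have hTt2 : (T ^ 2).trace = 0 := by rw [hT, smul_pow, Matrix.trace_smul, ht2, smul_zero]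
    obtain ⟨S, hS, hST⟩ := aux_bwd T hTd hTt hTt2
    have hT3 : T ^ 3 = 1 := by
      have hadj : T.adjugate.trace = 0 := by
        have := aux_adj T
        rw [hTt, hTt2] at this
        simpa using this
      have := aux_CH_s16 T
      rw [hadj, hTt, hTd] at this
      simpa [sub_eq_zero] using this
    have hM : A * B = k⁻¹ • T := by rw [hT, smul_smul, inv_mul_cancel₀ hk0, one_smul]
    have hST' : S * T * T = T ^ 2 * (S * T) := by rw [← mul_assoc, ← hST]
    have hSTT : S * T * T = T * S := by
      calc S * T * T = T ^ 2 * (S * T) := hST'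
        _ = T ^ 3 * T * S := by rw [hST, ← mul_assoc, ← pow_add, ← pow_succ]
        _ = T * S := by rw [hT3, one_mul]
    have h12 : S * (S * T) = T := by rw [← mul_assoc, hS, one_mul]
    have h22 : S * T * S = T ^ 2 := by rw [hST, mul_assoc, hS, mul_one]
    refine ⟨k, S, S * T, ?_, ?_, ?_, ?_, ?_, ?_⟩
    · rw [pow_two, hS]
    · rw [pow_two, ← mul_assoc, h22, ← pow_succ, hT3]
    · rw [h12, h22, ← hSTT, hST']
    · rw [h12, hT, smul_mul_assoc, mul_smul_comm, hMA]
    · rw [hM, smul_mul_assoc, mul_smul_comm, hSTT]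
    · rw [h12, hT]
end

section
/- Let (A, B, S₁, S₂) be a representation of LB₃ by complex 3×3 matrices. Suppose the minimal polynomial of A equals its characteristic polynomial and likewise for B, that Tr(AB) = 0, Tr(B²AB) = 0, Tr(B⁴AB) ≠ 0, and A ≠ B. Then there exists k ∈ ℂ such that S₁S₂ = k·AB. -/
open Polynomial in
lemma exists_cyclic_vec (A : Matrix (Fin 3) (Fin 3) ℂ) :
    ∃ v : Fin 3 → ℂ, ∀ p : ℂ[X], (aeval (Matrix.toLin' A) p) v = 0 → minpoly ℂ A ∣ p := by
  have ht : Module.IsTorsion ℂ[X] (Module.AEval' (Matrix.toLin' A)) :=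
    Module.AEval.isTorsion_of_finiteDimensional _ _ _
  obtain ⟨x, hx⟩ := Module.exists_ker_toSpanSingleton_eq_annihilator ℂ[X]
    (Module.AEval' (Matrix.toLin' A))
  refine ⟨(Module.AEval.of ℂ (Fin 3 → ℂ) (Matrix.toLin' A)).symm x, fun p hp => ?_⟩
  have h0 : p • x = 0 := by
    have := Module.AEval.of_symm_smul (a := Matrix.toLin' A) (R := ℂ) (M := Fin 3 → ℂ) p x
    apply (Module.AEval.of ℂ (Fin 3 → ℂ) (Matrix.toLin' A)).symm.injective
    rw [this, map_zero]
    exact hp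
  have h1 : p ∈ Module.annihilator ℂ[X] (Module.AEval' (Matrix.toLin' A)) := by
    rw [← hx]
    simpa using h0
  rw [← Polynomial.span_minpoly_eq_annihilator, Ideal.mem_span_singleton,
    Matrix.minpoly_toLin'] at h1
  exact h1

open Polynomial in
lemma commutant_poly (A G : Matrix (Fin 3) (Fin 3) ℂ) (hm : minpoly ℂ A = A.charpoly)
    (hc : G * A = A * G) : ∃ a b c : ℂ, G = a • 1 + b • A + c • (A * A) := by
  obtain ⟨v, hv⟩ := exists_cyclic_vec A
  have hdeg : (minpoly ℂ A).natDegree = 3 := by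
    rw [hm, Matrix.charpoly_natDegree_eq_dim]; simp
  have hli : LinearIndependent ℂ ![v, A.mulVec v, (A * A).mulVec v] := by
    rw [Fintype.linearIndependent_iff]
    intro g hg
    have hp := hv (C (g 0) + C (g 1) * X + C (g 2) * X ^ 2) (by
      simp only [Fin.sum_univ_three, Matrix.cons_val_zero, Matrix.cons_val_one,
        Matrix.cons_val] at hg
      simp only [map_add, map_mul, aeval_C, aeval_X, map_pow, pow_two]
      simpa [Algebra.algebraMap_eq_smul_one] using hg)
    have hz : (C (g 0) + C (g 1) * X + C (g 2) * X ^ 2 : ℂ[X]) = 0 := by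
      by_contra hne
      have h1 := Polynomial.natDegree_le_of_dvd hp hne
      have h2 : (C (g 0) + C (g 1) * X + C (g 2) * X ^ 2 : ℂ[X]).natDegree ≤ 2 := by
        compute_degree
      omega
    intro i
    have := congrArg (fun p => Polynomial.coeff p (i : ℕ)) hz
    fin_cases i <;> simpa [Polynomial.coeff_X, Polynomial.coeff_C, Polynomial.coeff_X_pow] using this
  have hspan := hli.span_eq_top_of_card_eq_finrank (by simp)
  have hGv : G.mulVec v ∈ Submodule.span ℂ (Set.range ![v, A.mulVec v, (A * A).mulVec v]) := by
    rw [hspan]; trivial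
  rw [Submodule.mem_span_range_iff_exists_fun] at hGv
  obtain ⟨g, hg⟩ := hGv
  refine ⟨g 0, g 1, g 2, ?_⟩
  set H : Matrix (Fin 3) (Fin 3) ℂ := g 0 • 1 + g 1 • A + g 2 • (A * A) with hH
  have hHA : H * A = A * H := by
    simp only [hH, add_mul, mul_add, smul_mul_assoc, mul_smul_comm, one_mul, mul_one, mul_assoc]
  have h0 : G.mulVec v = H.mulVec v := by
    rw [← hg]
    simp [hH, Fin.sum_univ_three, Matrix.add_mulVec, Matrix.smul_mulVec]
  have h1 : G.mulVec (A.mulVec v) = H.mulVec (A.mulVec v) := by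
    rw [Matrix.mulVec_mulVec, Matrix.mulVec_mulVec, hc, hHA, ← Matrix.mulVec_mulVec, h0,
      Matrix.mulVec_mulVec]
  have h2 : G.mulVec ((A * A).mulVec v) = H.mulVec ((A * A).mulVec v) := by
    have e : ∀ K : Matrix (Fin 3) (Fin 3) ℂ, K * A = A * K →
        K.mulVec ((A * A).mulVec v) = A.mulVec (K.mulVec (A.mulVec v)) := by
      intro K hK
      simp only [Matrix.mulVec_mulVec]
      rw [← mul_assoc, hK, mul_assoc, hK]
    rw [e G hc, e H hHA, h1]
  apply Matrix.toLin'.injective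
  apply LinearMap.ext_on_range hspan
  intro i
  fin_cases i
  · simpa using h0
  · simpa using h1
  · simpa using h2

lemma CH3 (P : Matrix (Fin 3) (Fin 3) ℂ) :
    P * P * P = P.trace • (P * P) - P.adjugate.trace • P + P.det • 1 := by
  ext i j
  fin_cases i <;> fin_cases j <;>
  simp [Matrix.mul_apply, Fin.sum_univ_three, Matrix.trace, Matrix.adjugate_fin_three, Matrix.det_fin_three] <;> ring

lemma comm_of_comm_sq (B X : Matrix (Fin 3) (Fin 3) ℂ) (t s d : ℂ)
    (h : B * B * B = t • (B * B) - s • B + d • 1) (hne : d - t * s ≠ 0)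
    (hX : X * (B * B) = (B * B) * X) : X * B = B * X := by
  have e1 : (B * B + s • 1) * B = t • (B * B) + d • 1 := by
    rw [add_mul, h]; simp only [smul_mul_assoc, one_mul]; abel
  have e1' : B * (B * B + s • 1) = t • (B * B) + d • 1 := by
    rw [mul_add, ← mul_assoc, h]; simp only [mul_smul_comm, mul_one]; abel
  have e2 : (B - t • 1) * (B * B + s • 1) = (d - t * s) • 1 := by
    rw [sub_mul, e1']; simp [smul_smul, sub_smul]
  have e3 : (B * B + s • 1) * (X * B - B * X) = 0 := by
    have : (B * B + s • 1) * X = X * (B * B + s • 1) := by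
      rw [add_mul, mul_add, hX]; simp
    rw [mul_sub, ← mul_assoc, this, mul_assoc, e1, ← mul_assoc, e1, mul_add, add_mul]
    simp [hX]
  have e4 : (d - t * s) • (X * B - B * X) = 0 := by
    rw [← one_mul (X * B - B * X), ← smul_mul_assoc, ← e2, mul_assoc, e3, mul_zero]
  exact sub_eq_zero.mp ((smul_eq_zero.mp e4).resolve_left hne)

theorem stmt_17 (A B S₁ S₂ : Matrix (Fin 3) (Fin 3) ℂ)
    (hA : IsUnit A) (hB : IsUnit B)
    (hS1 : S₁ ^ 2 = 1) (hS2 : S₂ ^ 2 = 1)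
    (hbr : A * B * A = B * A * B)
    (hs : S₁ * S₂ * S₁ = S₂ * S₁ * S₂)
    (hL1 : S₁ * S₂ * A = B * (S₁ * S₂))
    (hL2 : A * B * S₁ = S₂ * (A * B))
    (hmA : minpoly ℂ A = A.charpoly)
    (hmB : minpoly ℂ B = B.charpoly)
    (h1 : (A * B).trace = 0)
    (h2 : (B ^ 2 * A * B).trace = 0)
    (h3 : (B ^ 4 * A * B).trace ≠ 0)
    (hAB : A ≠ B) :
    ∃ k : ℂ, S₁ * S₂ = k • (A * B) := by
  have q1 : S₁ * S₁ = 1 := by rw [← pow_two, hS1]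
  have q2 : S₂ * S₂ = 1 := by rw [← pow_two, hS2]
  obtain ⟨P, hP⟩ : ∃ P, P = S₁ * S₂ := ⟨_, rfl⟩
  have hPS : P * S₁ = S₂ * P := by rw [hP, hs, mul_assoc]
  have hP3 : P * P * P = 1 := by
    have e : P * P * P = (S₁ * S₂ * S₁) * (S₂ * S₁ * S₂) := by rw [hP]; noncomm_ring
    rw [e, ← hs]
    calc S₁ * S₂ * S₁ * (S₁ * S₂ * S₁) = S₁ * S₂ * (S₁ * S₁) * S₂ * S₁ := by noncomm_ring
      _ = S₁ * (S₂ * S₂) * S₁ := by rw [q1]; noncomm_ring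
      _ = 1 := by rw [q2, mul_one, q1]
  have hP3' : P * (P * P) = 1 := by rw [← mul_assoc, hP3]
  have hPP : P * P = S₂ * S₁ := by
    have e : P * (S₂ * S₁) = 1 := by
      rw [hP, mul_assoc, ← mul_assoc S₂ S₂, q2, one_mul, q1]
    calc P * P = P * P * (P * (S₂ * S₁)) := by rw [e, mul_one]
      _ = P * P * P * (S₂ * S₁) := by noncomm_ring
      _ = S₂ * S₁ := by rw [hP3, one_mul]
  have hPu : IsUnit P := IsUnit.of_mul_eq_one _ hP3'
  rw [← hP] at hL1 ⊢
  have hMu : IsUnit (A * B) := hA.mul hB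
  have hPne : P ≠ 1 := by
    intro h; rw [h, one_mul, mul_one] at hL1; exact hAB hL1
  -- trace of `P`
  have hdet : P.det = 1 := by
    have a1 : P.det * S₁.det = S₂.det * P.det := by rw [← Matrix.det_mul, hPS, Matrix.det_mul]
    have a2 : S₁.det = S₂.det := by
      have : P.det ≠ 0 := ((Matrix.isUnit_iff_isUnit_det P).mp hPu).ne_zero
      apply mul_left_cancel₀ this; rw [a1, mul_comm]
    rw [hP, Matrix.det_mul, a2, ← Matrix.det_mul, q2, Matrix.det_one]
  have hadj : P.adjugate = P * P := by
    have e : P.adjugate * P = 1 := by rw [Matrix.adjugate_mul, hdet, one_smul]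
    calc P.adjugate = P.adjugate * (P * (P * P)) := by rw [hP3', mul_one]
      _ = P.adjugate * P * (P * P) := by rw [mul_assoc]
      _ = P * P := by rw [e, one_mul]
  have hadjt : P.adjugate.trace = P.trace := by
    rw [hadj, hPP, Matrix.trace_mul_comm, ← hP]
  have htr : P.trace = 0 := by
    have ch := CH3 P
    rw [hadjt, hdet, hP3, one_smul] at ch
    by_contra hne
    have e : P.trace • (P * P - P) = 0 := by
      rw [smul_sub]
      have := sub_eq_zero.mpr ch.symm
      rwa [add_sub_cancel_right] at this
    have e2 := sub_eq_zero.mp ((smul_eq_zero.mp e).resolve_left hne)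
    apply hPne
    apply hPu.mul_left_cancel
    rw [e2, mul_one]
  -- P = M g(A)
  obtain ⟨N, hN⟩ := hMu.exists_right_inv
  have hN' : N * (A * B) = 1 := mul_eq_one_comm.mp hN
  have hMG : A * B * (N * P) = P := by rw [← mul_assoc, hN, one_mul]
  have hMA : A * B * A = B * (A * B) := by rw [hbr, mul_assoc]
  obtain ⟨a, b, c, hG⟩ := commutant_poly A (N * P) hmA (by
    apply hMu.mul_left_cancel
    rw [← mul_assoc, hMG, hL1, ← mul_assoc (A * B) A, hMA, mul_assoc B, hMG])
  generalize N * P = G at hMG hG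
  -- traces
  have ch := CH3 B
  obtain ⟨t, ht⟩ : ∃ t, t = B.trace := ⟨_, rfl⟩
  obtain ⟨s, hs'⟩ : ∃ s, s = B.adjugate.trace := ⟨_, rfl⟩
  obtain ⟨d, hd⟩ : ∃ d, d = B.det := ⟨_, rfl⟩
  rw [← ht, ← hs', ← hd] at ch
  have h2' : (B * B * (A * B)).trace = 0 := by rw [← h2]; congr 1; noncomm_ring
  have t3 : (B * B * B * (A * B)).trace = - s * (B * (A * B)).trace := by
    rw [ch]
    simp only [add_mul, sub_mul, smul_mul_assoc, one_mul, Matrix.trace_add, Matrix.trace_sub,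
      Matrix.trace_smul, h1, h2', smul_eq_mul]
    ring
  have t4 : (B ^ 4 * A * B).trace = (d - t * s) * (B * (A * B)).trace := by
    have e : B ^ 4 * A * B = B * (B * B * B) * (A * B) := by noncomm_ring
    rw [e, ch]
    simp only [mul_add, mul_sub, add_mul, sub_mul, mul_smul_comm, smul_mul_assoc, mul_one,
      Matrix.trace_add, Matrix.trace_sub,
      Matrix.trace_smul, h2', smul_eq_mul, ← mul_assoc B B B]
    rw [t3]
    ring
  rw [t4] at h3
  have hne : d - t * s ≠ 0 := left_ne_zero_of_mul h3
  have hτ : (B * (A * B)).trace ≠ 0 := right_ne_zero_of_mul h3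
  have hMAA : A * B * (A * A) = B * B * (A * B) := by
    rw [← mul_assoc, hMA, mul_assoc B, hMA, ← mul_assoc]
  have hb : b = 0 := by
    have e : P.trace = b * (B * (A * B)).trace := by
      rw [← hMG, hG]
      simp only [mul_add, mul_smul_comm, mul_one, hMA, hMAA, Matrix.trace_add, Matrix.trace_smul,
        h1, h2', smul_eq_mul]
      ring
    rw [htr] at e
    exact (mul_eq_zero.mp e.symm).resolve_right hτ
  rw [hb, zero_smul, add_zero] at hG
  by_cases hc : c = 0
  · refine ⟨a, ?_⟩
    rw [← hMG, hG, hc]; simp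
  exfalso
  -- commuting with `G` implies commuting with `A`
  have chA : A * A * A = t • (A * A) - s • A + d • 1 := by
    apply hPu.mul_left_cancel
    have f2 : P * (A * A) = B * B * P := by rw [← mul_assoc, hL1, mul_assoc, hL1, mul_assoc]
    have f3 : P * (A * A * A) = B * B * B * P := by
      rw [← mul_assoc, f2, mul_assoc, hL1]; noncomm_ring
    rw [f3, ch]
    simp only [mul_add, mul_sub, add_mul, sub_mul, mul_smul_comm, smul_mul_assoc, mul_one, one_mul,
      f2, hL1]
  have key : ∀ X, X * G = G * X → X * A = A * X := by
    intro X hX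
    apply comm_of_comm_sq A X t s d chA hne
    rw [hG] at hX
    simp only [mul_add, add_mul, mul_smul_comm, smul_mul_assoc, mul_one, one_mul] at hX
    exact smul_right_injective _ hc (add_left_cancel hX)
  have kS : S₁ * A = A * S₁ := by
    apply key
    apply hMu.mul_left_cancel
    rw [← mul_assoc, hL2, mul_assoc, hMG, ← hPS, ← mul_assoc, hMG]
  have kP : (P * B) * A = A * (P * B) := by
    apply key
    have e : (P * B) * ((P * B) * G) = 1 := by
      calc (P * B) * ((P * B) * G) = P * (B * P) * B * G := by noncomm_ring
        _ = P * P * (A * B * G) := by rw [← hL1]; noncomm_ring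
        _ = 1 := by rw [hMG, hP3]
    have e2 : (P * B) * G * (P * B) = 1 := mul_eq_one_comm.mp e
    have hu : IsUnit (P * B) := hPu.mul hB
    apply hu.mul_left_cancel
    rw [e, ← mul_assoc, e2]
  -- D = P⁻¹ A P
  obtain ⟨D, hD⟩ : ∃ D, D = P * P * A * P := ⟨_, rfl⟩
  have hPD : P * D = A * P := by
    rw [hD]
    calc P * (P * P * A * P) = P * P * P * A * P := by noncomm_ring
      _ = A * P := by rw [hP3, one_mul]
  have hDP : D * P = P * B := by
    rw [hD]
    calc P * P * A * P * P = P * (P * A) * P * P := by noncomm_ring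
      _ = P * B * (P * P * P) := by rw [hL1]; noncomm_ring
      _ = P * B := by rw [hP3, mul_one]
  have hADBA : A * D = B * A := by
    have e1 : A * D = D * B := by
      apply hPu.mul_right_cancel
      rw [mul_assoc, hDP, ← kP, ← hDP, mul_assoc D P A, hL1, mul_assoc]
    have e2 : D * B = B * A := by
      apply hPu.mul_left_cancel
      rw [← mul_assoc, hPD, mul_assoc, ← kP, mul_assoc]
    rw [e1, e2]
  have hSB : S₁ * D = B * S₁ := by
    rw [hD, hPP]
    have : S₁ * (S₂ * S₁ * A * P) = S₁ * S₂ * (S₁ * A) * P := by noncomm_ring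
    rw [this, kS, ← hP, ← mul_assoc, hL1, hP]
    calc B * (S₁ * S₂) * S₁ * (S₁ * S₂) = B * S₁ * S₂ * (S₁ * S₁) * S₂ := by noncomm_ring
      _ = B * S₁ * (S₂ * S₂) := by rw [q1]; noncomm_ring
      _ = B * S₁ := by rw [q2, mul_one]
  have hSD : S₁ * B = D * S₁ := by
    calc S₁ * B = S₁ * (B * S₁) * S₁ := by rw [mul_assoc, mul_assoc, q1, mul_one]
      _ = D * S₁ := by rw [← hSB, ← mul_assoc, q1, one_mul]
  have hABDA : A * B = D * A := by
    have e : S₁ * (A * D) = S₁ * (B * A) := by rw [hADBA]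
    rw [← mul_assoc, kS, mul_assoc, hSB, ← mul_assoc, ← mul_assoc, hSD, mul_assoc D, kS,
      ← mul_assoc] at e
    have hu : IsUnit S₁ := IsUnit.of_mul_eq_one _ q1
    exact hu.mul_right_cancel e
  have hfin : B * A = A * B := by
    apply comm_of_comm_sq A B t s d chA hne
    rw [← mul_assoc, ← hADBA, mul_assoc, ← hABDA, ← mul_assoc]
  apply hAB
  apply hMu.mul_left_cancel
  rw [hbr, hfin]
end

section
/- Let (A, B, S₁, S₂) be an irreducible representation of LB₃ on a three-dimensional complex vector space V, with the spectrum of A equal to the spectrum of B equal to {λ₁, λ₂, λ₃} ⊂ ℂ. Suppose the minimal polynomial of A equals its characteristic polynomial and likewise for B, that (AB)³ = c·I for some c ∈ ℂ, and that (λ₁+λ₂)(λ₁+λ₃)(λ₂+λ₃) ≠ 0. Then there exists k ∈ ℂ such that S₁S₂ = k·AB. -/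
open Polynomial in
theorem aux_comm_s18 {V : Type*} [AddCommGroup V] [Module ℂ V] [FiniteDimensional ℂ V]
    (hdim : Module.finrank ℂ V = 3) (A C : Module.End ℂ V)
    (hmA : minpoly ℂ A = LinearMap.charpoly A) (hC : C * A = A * C) :
    ∃ x y z : ℂ, C = x • 1 + y • A + z • (A * A) := by
  have : Module.Finite ℂ (Module.AEval' A) := inferInstanceAs (Module.Finite ℂ V)
  have : Module.Finite ℂ[X] (Module.AEval' A) := inferInstance
  have htor : Module.IsTorsion ℂ[X] (Module.AEval' A) := by
    exact Module.AEval.isTorsion_of_finiteDimensional ℂ V A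
  obtain ⟨v0, hv0⟩ := Module.exists_ker_toSpanSingleton_eq_annihilator ℂ[X] (Module.AEval' A)
  rw [← span_minpoly_eq_annihilator] at hv0
  obtain ⟨v, rfl⟩ := (Module.AEval'.of A).surjective v0
  have key : ∀ p : ℂ[X], aeval A p v = 0 → minpoly ℂ A ∣ p := by
    intro p hp
    rw [← Ideal.mem_span_singleton, ← hv0, LinearMap.mem_ker, LinearMap.toSpanSingleton_apply]
    rw [← Module.AEval.of_aeval_smul]
    simp [hp]
  have hdeg : (minpoly ℂ A).natDegree = 3 := by
    rw [hmA, LinearMap.charpoly_natDegree, hdim]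
  have hli : LinearIndependent ℂ ![v, A v, A (A v)] := by
    rw [Fintype.linearIndependent_iff]
    intro g hg
    simp only [Fin.sum_univ_three, Matrix.cons_val_zero, Matrix.cons_val_one, Matrix.cons_val] at hg
    let p : ℂ[X] := Polynomial.C (g 2) * X ^ 2 + Polynomial.C (g 1) * X + Polynomial.C (g 0)
    have hd := key p (by
      simp only [p, map_add, map_mul, aeval_C, aeval_X, Algebra.algebraMap_eq_smul_one,
        LinearMap.add_apply, Module.End.mul_apply, LinearMap.smul_apply, Module.End.one_apply, pow_two]
      rw [← hg]; abel)
    have hp0 : p = 0 := by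
      by_contra hne
      have h1 := Polynomial.natDegree_le_of_dvd hd hne
      have h2 : p.natDegree ≤ 2 := Polynomial.natDegree_quadratic_le
      omega
    have c0 : p.coeff 0 = 0 := by rw [hp0]; simp
    have c1 : p.coeff 1 = 0 := by rw [hp0]; simp
    have c2 : p.coeff 2 = 0 := by rw [hp0]; simp
    simp [p, coeff_X, coeff_C] at c0 c1 c2
    intro i
    fin_cases i <;> assumption
  have hspan : ⊤ ≤ Submodule.span ℂ (Set.range ![v, A v, A (A v)]) := by
    rw [hli.span_eq_top_of_card_eq_finrank (by simp [hdim])]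
  have hrep : ∀ w : V, ∃ x y z : ℂ, w = x • v + y • A v + z • A (A v) := by
    intro w
    have hw := hspan (Submodule.mem_top : w ∈ ⊤)
    rw [Submodule.mem_span_range_iff_exists_fun] at hw
    obtain ⟨g, hg⟩ := hw
    refine ⟨g 0, g 1, g 2, ?_⟩
    rw [← hg]
    simp [Fin.sum_univ_three]
  obtain ⟨x, y, z, hxyz⟩ := hrep (C v)
  have hCA : ∀ w, C (A w) = A (C w) := fun w => LinearMap.congr_fun hC w
  refine ⟨x, y, z, ?_⟩
  ext w
  obtain ⟨a, b, d, rfl⟩ := hrep w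
  simp only [map_add, map_smul, hCA, hxyz, LinearMap.add_apply, LinearMap.smul_apply,
    Module.End.one_apply, Module.End.mul_apply]

theorem aux_mat_s18 (M N : Matrix (Fin 3) (Fin 3) ℂ) (h : M * N = 1)
    (hs : ∀ a ∈ M.charpoly.roots, ∀ b ∈ M.charpoly.roots, a + b ≠ 0) :
    M.trace * N.trace ≠ 1 := by
  have hdet : M.det ≠ 0 := by
    intro h0
    have := congrArg Matrix.det h
    simp [h0] at this
  have hN : M.det • N = M.adjugate := by
    calc M.det • N = (M.adjugate * M) * N := by rw [Matrix.adjugate_mul]; simp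
      _ = _ := by rw [mul_assoc, h, mul_one]
  have htr : M.det * N.trace = M.adjugate.trace := by
    rw [← hN, Matrix.trace_smul, smul_eq_mul]
  have hid : (Matrix.scalar (Fin 3) M.trace - M).det = M.trace * M.adjugate.trace - M.det := by
    rw [Matrix.adjugate_fin_three]
    simp [Matrix.det_fin_three, Matrix.trace, Fin.sum_univ_three]
    ring
  rw [← Matrix.eval_charpoly] at hid
  intro h1
  have hz : M.charpoly.eval M.trace = 0 := by
    rw [hid, ← htr]; linear_combination M.det * h1
  have hsp := IsAlgClosed.splits M.charpoly
  have hcard : M.charpoly.roots.card = 3 := by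
    rw [← hsp.natDegree_eq_card_roots, Matrix.charpoly_natDegree_eq_dim]; simp
  obtain ⟨a, b, c, habc⟩ := Multiset.card_eq_three.1 hcard
  have htrace := Matrix.trace_eq_sum_roots_charpoly M
  have hmem : M.trace ∈ M.charpoly.roots := by
    rw [Polynomial.mem_roots (Matrix.charpoly_monic M).ne_zero]; exact hz
  rw [htrace] at hmem
  rw [habc] at hs hmem
  simp at hs hmem
  rcases hmem with h | h | h
  · exact hs.2.1.2.2 (by linear_combination h)
  · exact hs.1.2.2 (by linear_combination h)
  · exact hs.1.2.1 (by linear_combination h)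

theorem aux_tr {V : Type*} [AddCommGroup V] [Module ℂ V] [FiniteDimensional ℂ V]
    (hdim : Module.finrank ℂ V = 3) (A Ai : Module.End ℂ V) (h : A * Ai = 1)
    (hs : ∀ a ∈ spectrum ℂ A, ∀ b ∈ spectrum ℂ A, a + b ≠ 0) :
    LinearMap.trace ℂ V A * LinearMap.trace ℂ V Ai ≠ 1 := by
  let b := Module.finBasisOfFinrankEq ℂ V hdim
  rw [LinearMap.trace_eq_matrix_trace ℂ b, LinearMap.trace_eq_matrix_trace ℂ b]
  apply aux_mat_s18
  · rw [← LinearMap.toMatrix_mul, h, LinearMap.toMatrix_one]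
  · rw [LinearMap.charpoly_toMatrix]
    intro x hx y hy
    refine hs x ?_ y ?_
    · rw [Module.End.mem_spectrum_iff_isRoot_charpoly]; exact Polynomial.isRoot_of_mem_roots hx
    · rw [Module.End.mem_spectrum_iff_isRoot_charpoly]; exact Polynomial.isRoot_of_mem_roots hy

theorem aux_cube {V : Type*} [AddCommGroup V] [Module ℂ V] [FiniteDimensional ℂ V]
    (hdim : Module.finrank ℂ V = 3) (M : Module.End ℂ V) (t : ℂ) (ht : t ≠ 0)
    (h : M * M * M = t ^ 3 • 1) :
    3 * t ^ 2 + t * LinearMap.trace ℂ V M + LinearMap.trace ℂ V (M * M) =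
      3 * t ^ 2 * Module.finrank ℂ (LinearMap.ker (M - t • 1)) := by
  have h' : ∀ v, M (M (M v)) = t ^ 3 • v := fun v => LinearMap.congr_fun h v
  have hp : LinearMap.IsProj (LinearMap.ker (M - t • 1))
      ((3 * t ^ 2)⁻¹ • (t ^ 2 • 1 + t • M + M * M)) := by
    constructor
    · intro v
      simp only [LinearMap.mem_ker, LinearMap.sub_apply, LinearMap.smul_apply, LinearMap.add_apply,
        Module.End.mul_apply, Module.End.one_apply, map_smul, map_add, h']
      module
    · intro v hv
      have hv' : M v = t • v := by
        simpa [sub_eq_zero] using hv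
      simp only [LinearMap.smul_apply, LinearMap.add_apply,
        Module.End.mul_apply, Module.End.one_apply, map_smul, hv', smul_smul, ← add_smul]
      rw [show (3 * t ^ 2)⁻¹ * (t ^ 2 + t * t + t * t) = 1 by field_simp; ring, one_smul]
  have := hp.trace
  simp only [map_smul, map_add, LinearMap.trace_one, hdim, smul_eq_mul] at this
  rw [← this]
  field_simp
  push_cast
  ring

theorem aux_sq_s18 {V : Type*} [AddCommGroup V] [Module ℂ V] [FiniteDimensional ℂ V]
    (hdim : Module.finrank ℂ V = 3) (M : Module.End ℂ V) (t : ℂ) (ht : t ≠ 0)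
    (h : M * M = t ^ 2 • 1) :
    3 * t + LinearMap.trace ℂ V M  =
      2 * t * Module.finrank ℂ (LinearMap.ker (M - t • 1)) := by
  have h' : ∀ v, M (M v) = t ^ 2 • v := fun v => LinearMap.congr_fun h v
  have hp : LinearMap.IsProj (LinearMap.ker (M - t • 1))
      ((2 * t)⁻¹ • (t • 1 + M)) := by
    constructor
    · intro v
      simp only [LinearMap.mem_ker, LinearMap.sub_apply, LinearMap.smul_apply, LinearMap.add_apply,
        Module.End.one_apply, map_smul, map_add, h']
      module
    · intro v hv
      have hv' : M v = t • v := by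
        simpa [sub_eq_zero] using hv
      simp only [LinearMap.smul_apply, LinearMap.add_apply,
        Module.End.one_apply, hv', smul_smul, ← add_smul]
      rw [show (2 * t)⁻¹ * (t + t) = 1 by field_simp; ring, one_smul]
  have := hp.trace
  simp only [map_smul, map_add, LinearMap.trace_one, hdim, smul_eq_mul] at this
  rw [← this]
  field_simp
  push_cast
  ring

theorem aux_omega : ∃ w : ℂ, w ^ 2 + w + 1 = 0 ∧ w ≠ 0 := by
  have h := Complex.isPrimitiveRoot_exp 3 (by norm_num)
  refine ⟨_, ?_, h.ne_zero (by norm_num)⟩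
  have h3 := h.pow_eq_one
  have h1 := h.ne_one (by norm_num)
  apply mul_left_cancel₀ (sub_ne_zero.2 h1)
  linear_combination h3

theorem aux_T {V : Type*} [AddCommGroup V] [Module ℂ V] [FiniteDimensional ℂ V]
    (hdim : Module.finrank ℂ V = 3) (T : Module.End ℂ V) (h3 : T * T * T = 1)
    (htr : LinearMap.trace ℂ V (T * T) = LinearMap.trace ℂ V T) (h1 : T ≠ 1) :
    LinearMap.trace ℂ V T = 0 ∧ Module.finrank ℂ (LinearMap.ker (T - (1 : ℂ) • 1)) = 1 := by
  obtain ⟨w, hw, hw0⟩ := aux_omega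
  have hw3 : w ^ 3 = 1 := by linear_combination (w - 1) * hw
  have e0 := aux_cube hdim T 1 one_ne_zero (by simpa using h3)
  have e1 := aux_cube hdim T w hw0 (by simpa [hw3] using h3)
  have hn : Module.finrank ℂ (LinearMap.ker (T - (1 : ℂ) • 1)) ≠ 3 := by
    intro h
    apply h1
    have := Submodule.eq_top_of_finrank_eq (h.trans hdim.symm)
    rw [LinearMap.ker_eq_top] at this
    simpa [sub_eq_zero] using this
  rw [htr] at e0 e1
  generalize Module.finrank ℂ (LinearMap.ker (T - (1 : ℂ) • 1)) = n at *
  generalize Module.finrank ℂ (LinearMap.ker (T - w • 1)) = m at *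
  generalize LinearMap.trace ℂ V T = t at *
  have e2 : 3 - t = 3 * (m : ℂ) := by
    linear_combination w * e1 + (-3 + 3 * m) * hw3 - t * hw
  have e3 : (n : ℂ) + 2 * m = 3 := by linear_combination -e0 / 3 - 2 / 3 * e2
  have e4 : n + 2 * m = 3 := by exact_mod_cast e3
  have hn1 : n = 1 := by omega
  have hm1 : m = 1 := by omega
  subst hm1
  refine ⟨?_, hn1⟩
  push_cast at e2
  linear_combination -e2

theorem aux_common {V : Type*} [AddCommGroup V] [Module ℂ V] [FiniteDimensional ℂ V]
    (hdim : Module.finrank ℂ V = 3)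
    (A B S₁ S₂ C : Module.End ℂ V)
    (hS1 : ∀ v, S₁ (S₁ v) = v)
    (hS2 : ∀ v, S₂ (S₂ v) = v)
    (hs : S₁ * S₂ * S₁ = S₂ * S₁ * S₂)
    (hbr : A * B * A = B * A * B)
    (hL2 : A * B * S₁ = S₂ * (A * B))
    (hirr : ∀ W : Submodule ℂ V,
      (∀ v ∈ W, A v ∈ W) → (∀ v ∈ W, B v ∈ W) →
      (∀ v ∈ W, S₁ v ∈ W) → (∀ v ∈ W, S₂ v ∈ W) →
      W = ⊥ ∨ W = ⊤)
    (hXC : A * B * C = S₁ * S₂) (hCA : C * A = A * C) (hCS : C * S₁ = S₁ * C)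
    (hT : Module.finrank ℂ (LinearMap.ker (S₁ * S₂ - (1 : ℂ) • 1)) = 1)
    (u : V) (hu : u ≠ 0) (a b g : ℂ) (ha : a ≠ 0) (hb : b ≠ 0)
    (hAu : A u = a • u) (hBu : B u = b • u) (hCu : C u = g • u) :
    ∃ k : ℂ, S₁ * S₂ = k • (A * B) := by
  have hXC' : ∀ v, A (B (C v)) = S₁ (S₂ v) := fun v => LinearMap.congr_fun hXC v
  have hCA' : ∀ v, C (A v) = A (C v) := fun v => LinearMap.congr_fun hCA v
  have hCS' : ∀ v, C (S₁ v) = S₁ (C v) := fun v => LinearMap.congr_fun hCS v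
  have hL2' : ∀ v, A (B (S₁ v)) = S₂ (A (B v)) := fun v => LinearMap.congr_fun hL2 v
  have hbr' : ∀ v, A (B (A v)) = B (A (B v)) := fun v => LinearMap.congr_fun hbr v
  have hs' : ∀ v, S₁ (S₂ (S₁ v)) = S₂ (S₁ (S₂ v)) := fun v => LinearMap.congr_fun hs v
  have hXu : A (B u) = (a * b) • u := by rw [hBu, map_smul, hAu, smul_smul, mul_comm]
  have hTu : S₁ (S₂ u) = (a * b * g) • u := by
    rw [← hXC', hCu, map_smul, map_smul, hXu, smul_smul]; congr 1; ring
  have hS2u : S₂ u = (a * b * g) • S₁ u := by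
    rw [← map_smul, ← hTu, hS1]
  by_cases hτ : a * b * g = 1
  · rw [hτ, one_smul] at hTu hS2u
    have m1 : u ∈ LinearMap.ker (S₁ * S₂ - (1 : ℂ) • 1) := by
      simp [hTu]
    have m2 : S₁ u ∈ LinearMap.ker (S₁ * S₂ - (1 : ℂ) • 1) := by
      have h5 : S₂ (S₁ u) = u := by rw [← hS2u, hS2]
      simp [h5]
    obtain ⟨s, hs1⟩ := (finrank_eq_one_iff_of_nonzero' (⟨u, m1⟩ : LinearMap.ker (S₁ * S₂ - (1 : ℂ) • 1))
      (by simpa using hu)).1 hT ⟨S₁ u, m2⟩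
    have hs2 : s • u = S₁ u := congrArg Subtype.val hs1
    exfalso
    have inv : ∀ (F : Module.End ℂ V) (r : ℂ), F u = r • u →
        ∀ v ∈ Submodule.span ℂ {u}, F v ∈ Submodule.span ℂ {u} := by
      intro F r hF v hv
      obtain ⟨q, rfl⟩ := Submodule.mem_span_singleton.1 hv
      rw [map_smul, hF, smul_smul]
      exact Submodule.mem_span_singleton.2 ⟨_, rfl⟩
    rcases hirr (Submodule.span ℂ {u}) (inv A a hAu) (inv B b hBu) (inv S₁ s hs2.symm)
      (inv S₂ s (by rw [hS2u, hs2])) with h | h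
    · exact hu (Submodule.span_singleton_eq_bot.1 h)
    · have := finrank_span_singleton (K := ℂ) hu
      rw [h, finrank_top, hdim] at this
      omega
  · have hab : a * b ≠ 0 := mul_ne_zero ha hb
    have hτ0 : a * b * g ≠ 0 := by
      intro h0
      rw [h0, zero_smul] at hS2u
      apply hu
      rw [← hS2 u, hS2u, map_zero]
    have hXx : A (B (S₁ u)) = (a * b * (a * b * g)) • S₁ u := by
      rw [hL2', hXu, map_smul, hS2u, smul_smul]
    have hx : S₁ u ≠ 0 := by
      intro h0; apply hu; rw [← hS1 u, h0, map_zero]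
    have hli : LinearIndependent ℂ ![u, S₁ u] := by
      rw [LinearIndependent.pair_iff]
      intro p q hpq
      have h2 : A (B (p • u + q • S₁ u)) = 0 := by rw [hpq]; simp
      simp only [map_add, map_smul, hXu, hXx] at h2
      have h3 : (q * (a * b) * (a * b * g - 1)) • S₁ u = 0 := by
        have : (q * (a * b) * (a * b * g - 1)) • S₁ u =
          (p • (a * b) • u + q • (a * b * (a * b * g)) • S₁ u) - (a * b) • (p • u + q • S₁ u) := by
          module
        rw [this, h2, hpq]; simp
      have hq : q = 0 := by
        have := (smul_eq_zero.1 h3).resolve_right hx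
        simpa [hab, ha, hb, sub_ne_zero.2 hτ] using this
      refine ⟨?_, hq⟩
      rw [hq, zero_smul, add_zero] at hpq
      exact (smul_eq_zero.1 hpq).resolve_right hu
    by_cases htop : LinearMap.ker (C - g • 1) = ⊤
    · refine ⟨g, ?_⟩
      rw [LinearMap.ker_eq_top, sub_eq_zero] at htop
      rw [← hXC, htop]; simp
    exfalso
    have hle : Submodule.span ℂ (Set.range ![u, S₁ u]) ≤ LinearMap.ker (C - g • 1) := by
      rw [Submodule.span_le]
      rintro _ ⟨i, rfl⟩
      fin_cases i
      · simp [hCu]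
      · simp [hCS', hCu]
    have hfr := finrank_span_eq_card hli
    have hlt := Submodule.finrank_lt (lt_top_iff_ne_top.2 htop).ne
    have heq := Submodule.eq_of_le_of_finrank_le hle (by
      rw [hfr]; simp only [Fintype.card_fin]; omega)
    have hmem : ∀ v, v ∈ LinearMap.ker (C - g • 1) ↔ C v = g • v := by
      intro v; simp [sub_eq_zero]
    have hrep : ∀ v ∈ LinearMap.ker (C - g • 1), ∃ p q : ℂ, v = p • u + q • S₁ u := by
      intro v hv
      rw [← heq, Submodule.mem_span_range_iff_exists_fun] at hv
      obtain ⟨f, hf⟩ := hv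
      exact ⟨f 0, f 1, by rw [← hf]; simp [Fin.sum_univ_two]⟩
    have hin : ∀ p q : ℂ, p • u + q • S₁ u ∈ LinearMap.ker (C - g • 1) := by
      intro p q
      rw [hmem]
      simp only [map_add, map_smul, hCS', hCu]
      module
    have hX : ∀ v ∈ LinearMap.ker (C - g • 1), A (B v) ∈ LinearMap.ker (C - g • 1) := by
      intro v hv
      obtain ⟨p, q, rfl⟩ := hrep v hv
      simp only [map_add, map_smul, hXu, hXx, smul_smul]
      exact hin _ _
    have hXs : ∀ v ∈ LinearMap.ker (C - g • 1), ∃ v' ∈ LinearMap.ker (C - g • 1),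
        v = A (B v') := by
      intro v hv
      obtain ⟨p, q, rfl⟩ := hrep v hv
      refine ⟨_, hin (p * (a * b)⁻¹) (q * (a * b * (a * b * g))⁻¹), ?_⟩
      have hne : a * b * (a * b * g) ≠ 0 := mul_ne_zero hab hτ0
      simp only [map_add, map_smul, hXu, hXx, smul_smul]
      rw [mul_assoc p, inv_mul_cancel₀ hab, mul_assoc q, inv_mul_cancel₀ hne, mul_one, mul_one]
    have hAi : ∀ v ∈ LinearMap.ker (C - g • 1), A v ∈ LinearMap.ker (C - g • 1) := by
      intro v hv
      rw [hmem] at hv ⊢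
      rw [hCA', hv, map_smul]
    have hSi : ∀ v ∈ LinearMap.ker (C - g • 1), S₁ v ∈ LinearMap.ker (C - g • 1) := by
      intro v hv
      rw [hmem] at hv ⊢
      rw [hCS', hv, map_smul]
    have hBi : ∀ v ∈ LinearMap.ker (C - g • 1), B v ∈ LinearMap.ker (C - g • 1) := by
      intro v hv
      obtain ⟨v', hv', rfl⟩ := hXs v hv
      rw [← hbr']
      exact hX _ (hAi _ hv')
    have hS2i : ∀ v ∈ LinearMap.ker (C - g • 1), S₂ v ∈ LinearMap.ker (C - g • 1) := by
      intro v hv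
      obtain ⟨v', hv', rfl⟩ := hXs v hv
      rw [← hL2']
      exact hX _ (hSi _ hv')
    rcases hirr (LinearMap.ker (C - g • 1)) hAi hBi hSi hS2i with h | h
    · have hm := (hmem u).2 hCu
      rw [h] at hm
      exact hu (by simpa using hm)
    · exact htop h

theorem aux_inter {V : Type*} [AddCommGroup V] [Module ℂ V] [FiniteDimensional ℂ V]
    (hdim : Module.finrank ℂ V = 3) (P Q : Submodule ℂ V)
    (h : 4 ≤ Module.finrank ℂ P + Module.finrank ℂ Q) : ∃ u, u ≠ 0 ∧ u ∈ P ∧ u ∈ Q := by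
  have h1 := Submodule.finrank_sup_add_finrank_inf_eq P Q
  have h2 := Submodule.finrank_le (P ⊔ Q)
  have h3 : P ⊓ Q ≠ ⊥ := by
    intro h0
    rw [h0, finrank_bot] at h1
    omega
  obtain ⟨u, hu, hu0⟩ := Submodule.exists_mem_ne_zero_of_ne_bot h3
  exact ⟨u, hu0, hu.1, hu.2⟩

/-- Theorem 4.5(b): an irreducible three-dimensional `LB₃` representation with
`Spec A = Spec B = {λ₁, λ₂, λ₃}`, minimal polynomials of `A` and `B` equal to
their characteristic polynomials, `(AB)³ = cI` and
`(λ₁+λ₂)(λ₁+λ₃)(λ₂+λ₃) ≠ 0` satisfies `S₁S₂ = k·AB` for some scalar `k`. -/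
theorem stmt_18 {V : Type*} [AddCommGroup V] [Module ℂ V] [FiniteDimensional ℂ V]
    (hdim : Module.finrank ℂ V = 3)
    (A B S₁ S₂ : Module.End ℂ V)
    (hA : IsUnit A) (hB : IsUnit B)
    (hS1 : S₁ ^ 2 = 1) (hS2 : S₂ ^ 2 = 1)
    (hbr : A * B * A = B * A * B)
    (hs : S₁ * S₂ * S₁ = S₂ * S₁ * S₂)
    (hL1 : S₁ * S₂ * A = B * (S₁ * S₂))
    (hL2 : A * B * S₁ = S₂ * (A * B))
    (hirr : ∀ W : Submodule ℂ V,
      (∀ v ∈ W, A v ∈ W) → (∀ v ∈ W, B v ∈ W) →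
      (∀ v ∈ W, S₁ v ∈ W) → (∀ v ∈ W, S₂ v ∈ W) →
      W = ⊥ ∨ W = ⊤)
    (l₁ l₂ l₃ : ℂ)
    (hsA : spectrum ℂ A = {l₁, l₂, l₃})
    (hsB : spectrum ℂ B = {l₁, l₂, l₃})
    (hmA : minpoly ℂ A = LinearMap.charpoly A)
    (hmB : minpoly ℂ B = LinearMap.charpoly B)
    (c : ℂ) (hc : (A * B) ^ 3 = c • 1)
    (hl : (l₁ + l₂) * (l₁ + l₃) * (l₂ + l₃) ≠ 0) :
    ∃ k : ℂ, S₁ * S₂ = k • (A * B) := by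
  have hspec : ∀ a ∈ spectrum ℂ A, ∀ b ∈ spectrum ℂ A, a + b ≠ 0 := by
    have h0 : ∀ a ∈ spectrum ℂ A, a ≠ 0 := by
      intro a ha h; subst h
      exact (spectrum.zero_notMem ℂ hA) ha
    have h12 : l₁ + l₂ ≠ 0 := fun h => hl (by rw [h]; ring)
    have h13 : l₁ + l₃ ≠ 0 := fun h => hl (by rw [h]; ring)
    have h23 : l₂ + l₃ ≠ 0 := fun h => hl (by rw [h]; ring)
    have hd : ∀ a ∈ spectrum ℂ A, a + a ≠ 0 := by
      intro a ha h
      exact h0 a ha (by linear_combination h / 2)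
    intro a ha b hb
    have ha' := hd a ha
    rw [hsA] at ha hb
    simp only [Set.mem_insert_iff, Set.mem_singleton_iff] at ha hb
    rcases ha with rfl | rfl | rfl <;> rcases hb with rfl | rfl | rfl <;>
      first | assumption | (rw [add_comm]; assumption)
  have hnt : Nontrivial V := Module.nontrivial_of_finrank_pos (R := ℂ) (by omega)
  obtain ⟨⟨A, Ai, hAAi, hAiA⟩, rfl⟩ := hA
  obtain ⟨⟨B, Bi, hBBi, hBiB⟩, rfl⟩ := hB
  simp only at *
  rw [pow_two] at hS1 hS2
  have hS1' : ∀ v, S₁ (S₁ v) = v := fun v => LinearMap.congr_fun hS1 v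
  have hS2' : ∀ v, S₂ (S₂ v) = v := fun v => LinearMap.congr_fun hS2 v
  have hAinj : ∀ v, A v = 0 → v = 0 := by
    intro v hv
    have := LinearMap.congr_fun hAiA v
    simpa [hv] using this.symm
  have hBinj : ∀ v, B v = 0 → v = 0 := by
    intro v hv
    have := LinearMap.congr_fun hBiB v
    simpa [hv] using this.symm
  by_cases hT1 : S₁ * S₂ = 1
  · -- degenerate case
    have hBA : B = A := by rw [hT1] at hL1; simpa using hL1.symm
    have hSS : S₂ = S₁ := by
      calc S₂ = (S₁ * S₁) * S₂ := by rw [hS1, one_mul]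
        _ = S₁ := by rw [mul_assoc, hT1, mul_one]
    subst hBA
    subst hSS
    obtain ⟨a, ha⟩ := Module.End.exists_eigenvalue B
    have ha' := Module.End.hasEigenvalue_iff_mem_spectrum.1 ha
    obtain ⟨u, hu⟩ := ha.exists_hasEigenvector
    have ha0 : a ≠ 0 := by
      intro h
      have := hspec a ha' a ha'
      simp [h] at this
    have hinj : ∀ v, B v = -a • v → v = 0 := by
      intro v hv
      by_contra hv0
      have hev : Module.End.HasEigenvalue B (-a) :=
        Module.End.hasEigenvalue_of_hasEigenvector (x := v)
          ⟨Module.End.mem_eigenspace_iff.2 hv, hv0⟩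
      exact hspec a ha' _ (Module.End.hasEigenvalue_iff_mem_spectrum.1 hev) (by ring)
    have hAinv : ∀ v ∈ LinearMap.ker (B - a • 1), B v ∈ LinearMap.ker (B - a • 1) := by
      intro v hv
      have hv' : B v = a • v := by simpa [sub_eq_zero] using hv
      rw [hv']; exact Submodule.smul_mem _ _ hv
    have hSinv : ∀ v ∈ LinearMap.ker (B - a • 1), S₂ v ∈ LinearMap.ker (B - a • 1) := by
      intro v hv
      have hv' : B v = a • v := by simpa [sub_eq_zero] using hv
      have h1 : B (B (S₂ v)) = S₂ (B (B v)) := LinearMap.congr_fun hL2 v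
      have h2 := hinj (B (S₂ v) - a • S₂ v) (by
        simp only [map_sub, map_smul, h1, hv']
        module)
      simpa using h2
    rcases hirr _ hAinv hAinv hSinv hSinv with h | h
    · exfalso
      have : u ∈ LinearMap.ker (B - a • 1) := by
        simp [hu.apply_eq_smul]
      rw [h] at this
      exact hu.2 (by simpa using this)
    · rw [LinearMap.ker_eq_top, sub_eq_zero] at h
      refine ⟨(a * a)⁻¹, ?_⟩
      rw [hT1, h]
      simp [smul_smul]
      field_simp
      simp
  -- main case
  have hXXi : A * B * (Bi * Ai) = 1 := by
    rw [mul_assoc, ← mul_assoc B, hBBi, one_mul, hAAi]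
  have hXiX : Bi * Ai * (A * B) = 1 := by
    rw [mul_assoc, ← mul_assoc Ai, hAiA, one_mul, hBiB]
  have hTS : S₁ * S₂ * S₁ = S₂ * (S₁ * S₂) := by rw [hs, mul_assoc]
  have hXA : A * B * A = B * (A * B) := by rw [hbr, mul_assoc]
  obtain ⟨X, hX⟩ : ∃ X, X = A * B := ⟨_, rfl⟩
  obtain ⟨Xi, hXi⟩ : ∃ Xi, Xi = Bi * Ai := ⟨_, rfl⟩
  obtain ⟨T, hT⟩ : ∃ T, T = S₁ * S₂ := ⟨_, rfl⟩
  rw [← hX, ← hXi] at hXXi hXiX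
  rw [← hX] at hXA hL2 hc
  rw [← hT] at hL1 hTS hT1
  obtain ⟨C, hC⟩ : ∃ C, C = Xi * T := ⟨_, rfl⟩
  have hXC : X * C = T := by rw [hC, ← mul_assoc, hXXi, one_mul]
  have hAXi : A * Xi = Xi * B := by
    calc A * Xi = (Xi * X) * A * Xi := by rw [hXiX, one_mul]
      _ = Xi * (X * A) * Xi := by noncomm_ring
      _ = Xi * B * (X * Xi) := by rw [hXA]; noncomm_ring
      _ = _ := by rw [hXXi, mul_one]
  have hSXi : S₁ * Xi = Xi * S₂ := by
    calc S₁ * Xi = (Xi * X) * S₁ * Xi := by rw [hXiX, one_mul]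
      _ = Xi * (X * S₁) * Xi := by noncomm_ring
      _ = Xi * S₂ * (X * Xi) := by rw [hL2]; noncomm_ring
      _ = _ := by rw [hXXi, mul_one]
  have hCA : C * A = A * C := by
    rw [hC, mul_assoc, hL1, ← mul_assoc, ← hAXi, mul_assoc]
  have hCS : C * S₁ = S₁ * C := by
    rw [hC, mul_assoc, hTS, ← mul_assoc, ← hSXi, mul_assoc]
  have hT3 : T * T * T = 1 := by
    calc T * T * T = (T * S₁) * (S₂ * S₁ * S₂) := by
          conv_lhs => rw [mul_assoc, hT]
          rw [hT]; noncomm_ring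
      _ = S₂ * S₁ * (S₂ * S₂) * S₁ * S₂ := by rw [hTS, hT]; noncomm_ring
      _ = S₂ * (S₁ * S₁) * S₂ := by rw [hS2]; noncomm_ring
      _ = 1 := by rw [hS1, mul_one, hS2]
  have hTT : T * T = S₂ * S₁ := by
    calc T * T = (T * S₁) * S₂ := by rw [hT]; noncomm_ring
      _ = S₂ * S₁ * (S₂ * S₂) := by rw [hTS, hT]; noncomm_ring
      _ = _ := by rw [hS2, mul_one]
  have htrT2 : LinearMap.trace ℂ V (T * T) = LinearMap.trace ℂ V T := by
    rw [hTT, LinearMap.trace_mul_comm, hT]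
  obtain ⟨htrT, hkT⟩ := aux_T hdim T hT3 htrT2 hT1
  obtain ⟨x, y, z, hxyz⟩ := aux_comm_s18 hdim A (A * C) hmA (by rw [mul_assoc, hCA])
  have hCp : C = x • Ai + y • 1 + z • A := by
    calc C = Ai * (A * C) := by rw [← mul_assoc, hAiA, one_mul]
      _ = x • Ai + y • (Ai * A) + z • ((Ai * A) * A) := by rw [hxyz]; noncomm_ring
      _ = _ := by rw [hAiA, one_mul]
  by_contra hcon
  have hno : ∀ u, u ≠ 0 → ∀ a b : ℂ, A u = a • u → B u = b • u → False := by
    intro u hu a b hAu hBu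
    have ha : a ≠ 0 := by
      rintro rfl; exact hu (hAinj u (by simpa using hAu))
    have hb : b ≠ 0 := by
      rintro rfl; exact hu (hBinj u (by simpa using hBu))
    have hAiu : Ai u = a⁻¹ • u := by
      have h1 : Ai (A u) = u := LinearMap.congr_fun hAiA u
      rw [hAu, map_smul] at h1
      rw [eq_inv_smul_iff₀ ha, h1]
    apply hcon
    refine aux_common hdim A B S₁ S₂ C hS1' hS2' hs hbr (by rw [← hX]; exact hL2) hirr
      (by rw [← hX, ← hT]; exact hXC) hCA hCS (by rw [← hT]; exact hkT) u hu a b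
      (x * a⁻¹ + y + z * a) ha hb hAu hBu ?_
    rw [hCp]
    simp only [LinearMap.add_apply, LinearMap.smul_apply, Module.End.one_apply, hAiu, hAu]
    module
  obtain ⟨Y, hY⟩ : ∃ Y, Y = X * A := ⟨_, rfl⟩
  have hX3 : X * X * X = c • 1 := by rw [← hc]; noncomm_ring
  have hYY : Y * Y = c • 1 := by
    rw [← hX3, hY]
    nth_rewrite 2 [hXA]
    rw [hX]; noncomm_ring
  have hc0 : c ≠ 0 := by
    rintro rfl
    rw [zero_smul] at hX3
    have : (1 : Module.End ℂ V) = 0 := by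
      calc (1 : Module.End ℂ V) = X * Xi := hXXi.symm
        _ = X * (X * Xi) * Xi := by rw [hXXi, mul_one, hXXi]
        _ = X * (X * (X * Xi) * Xi) * Xi := by simp only [hXXi, mul_one]
        _ = (X * X * X) * Xi * Xi * Xi := by noncomm_ring
        _ = 0 := by rw [hX3]; simp
    exact one_ne_zero this
  have hXY : ∀ t d : ℂ, t ≠ 0 → Module.finrank ℂ (LinearMap.ker (X - t • 1)) +
      Module.finrank ℂ (LinearMap.ker (Y - d • 1)) ≤ 3 := by
    intro t d ht
    by_contra hlt
    obtain ⟨u, hu, h1, h2⟩ := aux_inter hdim (LinearMap.ker (X - t • 1)) (LinearMap.ker (Y - d • 1))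
      (by omega)
    have h1' : X u = t • u := by simpa [sub_eq_zero] using h1
    have h2' : Y u = d • u := by simpa [sub_eq_zero] using h2
    refine hno u hu (d / t) (d / t) ?_ ?_
    · have e1 : X (A u) = d • u := by rw [← h2', hY]; rfl
      have e2 : Xi (X (A u)) = A u := LinearMap.congr_fun hXiX _
      have e3 : Xi (X u) = u := LinearMap.congr_fun hXiX _
      rw [h1', map_smul] at e3
      have e4 : Xi u = t⁻¹ • u := by rw [eq_inv_smul_iff₀ ht, e3]
      rw [← e2, e1, map_smul, e4, smul_smul, div_eq_mul_inv]
    · have e1 : B (X u) = d • u := by rw [← h2', hY, hXA]; rfl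
      rw [h1', map_smul] at e1
      rw [div_eq_inv_mul, mul_smul, ← e1, inv_smul_smul₀ ht]
  obtain ⟨d, hd⟩ := IsAlgClosed.exists_pow_nat_eq c (n := 2) (by norm_num)
  obtain ⟨t, ht⟩ := IsAlgClosed.exists_pow_nat_eq c (n := 3) (by norm_num)
  obtain ⟨w, hw, hw0⟩ := aux_omega
  have hw3 : w ^ 3 = 1 := by linear_combination (w - 1) * hw
  have hd0 : d ≠ 0 := by rintro rfl; exact hc0 (by rw [← hd]; norm_num)
  have ht0 : t ≠ 0 := by rintro rfl; exact hc0 (by rw [← ht]; norm_num)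
  have q0 := aux_cube hdim X t ht0 (by rw [ht, hX3])
  have q1 := aux_cube hdim X (w * t) (mul_ne_zero hw0 ht0) (by rw [mul_pow, hw3, one_mul, ht, hX3])
  have q2 := aux_cube hdim X (w ^ 2 * t) (mul_ne_zero (pow_ne_zero _ hw0) ht0)
    (by rw [mul_pow, ← pow_mul, mul_comm 2 3, pow_mul, hw3, one_pow, one_mul, ht, hX3])
  have r0 := aux_sq_s18 hdim Y d hd0 (by rw [hd, hYY])
  have r1 := aux_sq_s18 hdim Y (-d) (neg_ne_zero.2 hd0) (by rw [neg_sq, hd, hYY])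
  have g1 := hXY t d ht0
  have g2 := hXY t (-d) ht0
  have g3 := hXY (w * t) d (mul_ne_zero hw0 ht0)
  have g4 := hXY (w * t) (-d) (mul_ne_zero hw0 ht0)
  have g5 := hXY (w ^ 2 * t) d (mul_ne_zero (pow_ne_zero _ hw0) ht0)
  have g6 := hXY (w ^ 2 * t) (-d) (mul_ne_zero (pow_ne_zero _ hw0) ht0)
  obtain ⟨⟨htX, p4⟩, hsY⟩ : (LinearMap.trace ℂ V X = 0 ∧ LinearMap.trace ℂ V (X * X) = 0) ∧ LinearMap.trace ℂ V Y ^ 2 = c := by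
    generalize Module.finrank ℂ (LinearMap.ker (X - t • 1)) = n0 at *
    generalize Module.finrank ℂ (LinearMap.ker (X - (w * t) • 1)) = n1 at *
    generalize Module.finrank ℂ (LinearMap.ker (X - (w ^ 2 * t) • 1)) = n2 at *
    generalize Module.finrank ℂ (LinearMap.ker (Y - d • 1)) = m0 at *
    generalize Module.finrank ℂ (LinearMap.ker (Y - (-d) • 1)) = m1 at *
    generalize LinearMap.trace ℂ V X = tX at *
    generalize LinearMap.trace ℂ V (X * X) = tXX at *
    generalize LinearMap.trace ℂ V Y = tY at *
    have hm : m0 + m1 = 3 := by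
      have : (m0 : ℂ) + m1 = 3 := by
        apply mul_left_cancel₀ (mul_ne_zero two_ne_zero hd0)
        linear_combination r1 - r0
      exact_mod_cast this
    have q1' : 3 * t ^ 2 + w ^ 2 * t * tX + w * tXX = 3 * t ^ 2 * n1 := by
      linear_combination w * q1 + (3 * t ^ 2 * n1 - 3 * t ^ 2) * hw3
    have q2' : 3 * t ^ 2 + w * t * tX + w ^ 2 * tXX = 3 * t ^ 2 * n2 := by
      linear_combination w ^ 2 * q2 + (3 * t ^ 2 * n2 - 3 * t ^ 2) * (w ^ 3 + 1) * hw3 - w * t * tX * hw3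
    have hn : n0 + n1 + n2 = 3 := by
      have : (n0 : ℂ) + n1 + n2 = 3 := by
        apply mul_left_cancel₀ (mul_ne_zero three_ne_zero (pow_ne_zero 2 ht0))
        linear_combination (t * tX + tXX) * hw - q0 - q1' - q2'
      exact_mod_cast this
    have hn0 : n0 = 1 := by omega
    have hn1 : n1 = 1 := by omega
    subst hn0
    subst hn1
    constructor
    · have k1 : t * tX + tXX = 0 := by push_cast at q0; linear_combination q0
      have k2 : w * t * tX + tXX = 0 := by
        apply mul_left_cancel₀ hw0; push_cast at q1'; linear_combination q1'
      have hw1 : w - 1 ≠ 0 := by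
        intro h
        rw [sub_eq_zero] at h
        rw [h] at hw; norm_num at hw
      have k3 : tX = 0 := by
        apply mul_left_cancel₀ (mul_ne_zero hw1 ht0)
        linear_combination k2 - k1
      exact ⟨k3, by linear_combination k1 - t * k3⟩
    · have hm0 : m0 = 1 ∨ m0 = 2 := by omega
      rcases hm0 with h | h <;> subst h <;> push_cast at r0
      · linear_combination (tY - d) * r0 + hd
      · linear_combination (tY + d) * r0 + hd
  -- the two trace equations
  have htAB : LinearMap.trace ℂ V B = LinearMap.trace ℂ V A := by
    calc LinearMap.trace ℂ V B = LinearMap.trace ℂ V ((B * X) * Xi) := by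
          rw [mul_assoc, hXXi, mul_one]
      _ = LinearMap.trace ℂ V (Xi * (X * A)) := by rw [← hXA, LinearMap.trace_mul_comm]
      _ = _ := by rw [← mul_assoc, hXiX, one_mul]
  have hXAi : X * Ai = Bi * X := by
    calc X * Ai = (Bi * B) * X * Ai := by rw [hBiB, one_mul]
      _ = Bi * (B * X) * Ai := by noncomm_ring
      _ = Bi * X * (A * Ai) := by rw [← hXA]; noncomm_ring
      _ = _ := by rw [hAAi, mul_one]
  have htABi : LinearMap.trace ℂ V Bi = LinearMap.trace ℂ V Ai := by
    calc LinearMap.trace ℂ V Bi = LinearMap.trace ℂ V ((Bi * X) * Xi) := by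
          rw [mul_assoc, hXXi, mul_one]
      _ = LinearMap.trace ℂ V (Xi * (X * Ai)) := by rw [← hXAi, LinearMap.trace_mul_comm]
      _ = _ := by rw [← mul_assoc, hXiX, one_mul]
  have p1 : LinearMap.trace ℂ V (X * Ai) = LinearMap.trace ℂ V A := by
    rw [hX, LinearMap.trace_mul_comm, ← mul_assoc, hAiA, one_mul, htAB]
  have hXX : X * X = c • Xi := by
    calc X * X = X * X * X * Xi := by rw [mul_assoc (X * X), hXXi, mul_one]
      _ = _ := by rw [hX3]; simp
  have p2 : LinearMap.trace ℂ V (X * X * A) = c * LinearMap.trace ℂ V Ai := by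
    rw [hXX, hXi, smul_mul_assoc, mul_assoc, hAiA, mul_one, map_smul, htABi, smul_eq_mul]
  have p3 : LinearMap.trace ℂ V (X * X * Ai) = LinearMap.trace ℂ V Y := by
    calc LinearMap.trace ℂ V (X * X * Ai) = LinearMap.trace ℂ V (A * (B * X) * Ai) := by
          congr 1; nth_rewrite 1 [hX]; noncomm_ring
      _ = LinearMap.trace ℂ V (A * X * (A * Ai)) := by rw [← hXA]; noncomm_ring
      _ = _ := by rw [hAAi, mul_one, hY, LinearMap.trace_mul_comm]
  have E1 : x * LinearMap.trace ℂ V A + z * LinearMap.trace ℂ V Y = 0 := by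
    rw [← hXC, hCp] at htrT
    simp only [mul_add, mul_smul_comm, map_add, map_smul, smul_eq_mul, mul_one, p1, htX, ← hY] at htrT
    linear_combination htrT
  have E2 : x * LinearMap.trace ℂ V Y + z * (c * LinearMap.trace ℂ V Ai) = 0 := by
    have h1 : LinearMap.trace ℂ V (X * X * C) = 0 := by
      rw [mul_assoc, hXC, LinearMap.trace_mul_comm, hT, mul_assoc, ← hL2, ← mul_assoc,
        LinearMap.trace_mul_comm, ← mul_assoc, hS1, one_mul, htX]
    rw [hCp] at h1
    simp only [mul_add, mul_smul_comm, map_add, map_smul, smul_eq_mul, mul_one, p2, p3, p4] at h1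
    linear_combination h1
  have hne := aux_tr hdim A Ai hAAi hspec
  have hD : c * (LinearMap.trace ℂ V A * LinearMap.trace ℂ V Ai - 1) ≠ 0 :=
    mul_ne_zero hc0 (sub_ne_zero.2 hne)
  have hx0 : x = 0 := by
    apply mul_left_cancel₀ hD
    linear_combination c * LinearMap.trace ℂ V Ai * E1 - LinearMap.trace ℂ V Y * E2 + x * hsY
  have hz0 : z = 0 := by
    apply mul_left_cancel₀ hD
    linear_combination LinearMap.trace ℂ V A * E2 - LinearMap.trace ℂ V Y * E1 + z * hsY
  apply hcon
  refine ⟨y, ?_⟩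
  rw [← hT, ← hX, ← hXC, hCp, hx0, hz0]
  simp
end
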